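/- Every nontrivial finite solvable group G with derived length d satisfies (9 : ℝ)^((d−3)/9) < Ω(|G|), where Ω(|G|) is the number of prime factors of |G| counted with multiplicity. -/

import Mathlib

/-- `Omega n` is the number of prime factors of `n` counted with multiplicity,
usually denoted `Ω(n)`.  For a finite solvable group `G`, `Omega (Nat.card G)`
is the composition length of `G`. -/
def Omega (n : ℕ) : ℕ := n.primeFactorsList.length

/-- `DerivedLengthEq G d` says that the derived (solvable) length of `G` is exactly `d`:
the `d`-th term of the derived series is trivial and no earlier term is trivial. -/
def DerivedLengthEq (G : Type*) [Group G] (d : ℕ) : Prop :=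
  derivedSeries G d = ⊥ ∧ ∀ k < d, derivedSeries G k ≠ ⊥


namespace DL

def gb (k : ℕ) : ℕ := Nat.log 2 (k ^ 9) / 5

def fb (p w : ℕ) : ℕ :=
  if w = 1 then (if p = 2 then 0 else 1)
  else if w = 2 then (if p = 2 then 2 else 4)
  else if p = 2 ∧ w ≤ 8 then w
  else Nat.log 2 (w ^ 9 * 2 ^ 23) / 5

lemma le_gb {t k : ℕ} (hk : 0 < k) : t ≤ gb k ↔ 2 ^ (5 * t) ≤ k ^ 9 := by
  unfold gb
  rw [Nat.le_div_iff_mul_le (by norm_num), mul_comm t 5]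
  exact Nat.le_log_iff_pow_le (by norm_num) (by positivity)

lemma le_hb {t k : ℕ} (hk : 0 < k) :
    t ≤ Nat.log 2 (k ^ 9 * 2 ^ 23) / 5 ↔ 2 ^ (5 * t) ≤ k ^ 9 * 2 ^ 23 := by
  rw [Nat.le_div_iff_mul_le (by norm_num), mul_comm t 5]
  exact Nat.le_log_iff_pow_le (by norm_num) (by positivity)

lemma gb_pow (k : ℕ) (hk : 0 < k) : 2 ^ (5 * gb k) ≤ k ^ 9 := (le_gb hk).1 le_rfl

lemma fb_one (p : ℕ) : fb p 1 ≤ 1 := by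
  unfold fb; simp; split_ifs <;> simp

lemma fb_two (p : ℕ) : fb p 2 ≤ 4 := by
  unfold fb; simp; split_ifs <;> simp

lemma fb_two_small {w : ℕ} (h : w ≤ 8) : fb 2 w ≤ w := by
  unfold fb; simp [h]; split_ifs <;> omega

lemma fb_pow (p w : ℕ) (hw : 0 < w) : 2 ^ (5 * fb p w) ≤ w ^ 9 * 2 ^ 23 := by
  by_cases h1 : w = 1
  · subst h1
    calc 2 ^ (5 * fb p 1) ≤ 2 ^ (5 * 1) := Nat.pow_le_pow_right (by norm_num) (by have := fb_one p; omega)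
      _ ≤ _ := by norm_num
  by_cases h2 : w = 2
  · subst h2
    calc 2 ^ (5 * fb p 2) ≤ 2 ^ (5 * 4) := Nat.pow_le_pow_right (by norm_num) (by have := fb_two p; omega)
      _ ≤ _ := by norm_num
  by_cases h3 : p = 2 ∧ w ≤ 8
  · obtain ⟨rfl, h3⟩ := h3
    calc 2 ^ (5 * fb 2 w) ≤ 2 ^ (5 * w) := Nat.pow_le_pow_right (by norm_num) (by have := fb_two_small h3; omega)
      _ ≤ _ := by interval_cases w <;> norm_num
  · have : fb p w = Nat.log 2 (w ^ 9 * 2 ^ 23) / 5 := by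
      unfold fb; rw [if_neg h1, if_neg h2, if_neg h3]
    rw [this]
    exact (le_hb hw).1 le_rfl

lemma gb_mul {k l : ℕ} (hk : 0 < k) (hl : 0 < l) : gb k + gb l ≤ gb (k * l) := by
  rw [le_gb (by positivity), mul_add, pow_add, mul_pow]
  exact Nat.mul_le_mul (gb_pow k hk) (gb_pow l hl)

lemma gb_two : gb 2 = 1 := by unfold gb; norm_num
lemma gb_three : gb 3 = 2 := by unfold gb; norm_num
lemma gb_four : gb 4 = 3 := by unfold gb; norm_num
lemma gb_small {k : ℕ} (h : 0 < k) (h8 : k ≤ 8) : gb k ≤ k := by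
  by_contra hc
  have := (le_gb (t := k + 1) h).1 (by omega)
  revert this
  interval_cases k <;> norm_num

lemma fb_gen {p w : ℕ} (h1 : w ≠ 1) (h2 : w ≠ 2) (h3 : ¬ (p = 2 ∧ w ≤ 8)) :
    fb p w = Nat.log 2 (w ^ 9 * 2 ^ 23) / 5 := by
  unfold fb; rw [if_neg h1, if_neg h2, if_neg h3]

lemma fb_imprim (p : ℕ) {k w : ℕ} (hk : 2 ≤ k) (hw : 0 < w) : gb k + fb p w ≤ fb p (k * w) := by
  have h1 : k * w ≠ 1 := by nlinarith
  by_cases h2 : k * w = 2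
  · have hw1 : w = 1 := by nlinarith
    subst hw1
    have hk2 : k = 2 := by omega
    subst hk2
    rw [gb_two]; unfold fb; simp; split_ifs <;> simp
  by_cases h3 : p = 2 ∧ k * w ≤ 8
  · obtain ⟨rfl, h3⟩ := h3
    have hk8 : k ≤ 8 := by nlinarith
    have hR : fb 2 (k * w) = k * w := by
      unfold fb; rw [if_neg h1, if_neg h2, if_pos ⟨rfl, h3⟩]
    rw [hR]
    have hw4 : w ≤ 4 := by nlinarith
    have hg := gb_small (by omega) hk8
    have hf := fb_two_small (w := w) (by omega)
    by_cases hw1 : w = 1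
    · subst hw1
      have : fb 2 1 = 0 := by unfold fb; simp
      omega
    · have : 2 ≤ w := by omega
      nlinarith
  · rw [fb_gen h1 h2 h3, le_hb (by positivity), mul_add, pow_add, mul_pow, mul_assoc]
    exact Nat.mul_le_mul (gb_pow k (by omega)) (fb_pow p w hw)

lemma aux1 (a : ℕ) (h : 7 ≤ a) : 16 * a ≤ 2 ^ a := by
  induction a, h using Nat.le_induction with
  | base => norm_num
  | succ n hn ih => rw [pow_succ]; omega

lemma aux2 (a : ℕ) (h : 3 ≤ a) : 9 * a ≤ 3 ^ a := by
  induction a, h using Nat.le_induction with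
  | base => norm_num
  | succ n hn ih => rw [pow_succ]; omega

lemma aux3 (a : ℕ) (h : 9 ≤ a) : 5 * a ^ 2 ≤ 2 ^ a := by
  induction a, h using Nat.le_induction with
  | base => norm_num
  | succ n hn ih => rw [pow_succ 2 n]; nlinarith

lemma aux4 (a : ℕ) (h : 4 ≤ a) : 5 * a ^ 2 ≤ 3 ^ a := by
  induction a, h using Nat.le_induction with
  | base => norm_num
  | succ n hn ih => rw [pow_succ 3 n]; nlinarith

lemma fb_prim_perm {q a : ℕ} (hq : 2 ≤ q) (ha : 0 < a) : fb q a + 1 ≤ gb (q ^ a) := by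
  rw [le_gb (by positivity), mul_add, pow_add]
  by_cases h2 : q = 2
  · subst h2
    by_cases h8 : a ≤ 8
    · by_cases h1 : a = 1
      · subst h1; unfold fb; norm_num
      · calc 2 ^ (5 * fb 2 a) * 2 ^ (5 * 1) ≤ 2 ^ (5 * a) * 2 ^ (5 * 1) := by
              gcongr
              · norm_num
              · exact fb_two_small h8
          _ = 2 ^ (5 * a + 5) := by rw [pow_add]
          _ ≤ 2 ^ (a * 9) := Nat.pow_le_pow_right (by norm_num) (by omega)
          _ = _ := by rw [pow_mul]
    · calc 2 ^ (5 * fb 2 a) * 2 ^ (5 * 1) ≤ (a ^ 9 * 2 ^ 23) * 2 ^ (5 * 1) := by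
            gcongr; exact fb_pow 2 a ha
        _ = a ^ 9 * 2 ^ 28 := by ring
        _ ≤ a ^ 9 * 16 ^ 9 := Nat.mul_le_mul_left _ (by norm_num)
        _ = (16 * a) ^ 9 := by ring
        _ ≤ _ := by gcongr; exact aux1 a (by omega)
  · have h3 : 3 ≤ q := by omega
    refine le_trans ?_ (Nat.pow_le_pow_left (Nat.pow_le_pow_left h3 a) 9)
    by_cases h1 : a = 1
    · subst h1
      calc 2 ^ (5 * fb q 1) * 2 ^ (5 * 1) ≤ 2 ^ (5 * 1) * 2 ^ (5 * 1) := by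
              gcongr
              · norm_num
              · exact fb_one q
        _ ≤ _ := by norm_num
    by_cases h2 : a = 2
    · subst h2
      calc 2 ^ (5 * fb q 2) * 2 ^ (5 * 1) ≤ 2 ^ (5 * 4) * 2 ^ (5 * 1) := by
              gcongr
              exact fb_two q
        _ ≤ _ := by norm_num
    · calc 2 ^ (5 * fb q a) * 2 ^ (5 * 1) ≤ (a ^ 9 * 2 ^ 23) * 2 ^ (5 * 1) := by
            gcongr; exact fb_pow q a ha
        _ = a ^ 9 * 2 ^ 28 := by ring
        _ ≤ a ^ 9 * 9 ^ 9 := Nat.mul_le_mul_left _ (by norm_num)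
        _ = (9 * a) ^ 9 := by ring
        _ ≤ _ := by gcongr; exact aux2 a (by omega)

lemma fb_ge_two {p w : ℕ} (hw : 2 ≤ w) : 2 ≤ fb p w := by
  by_cases h2 : w = 2
  · subst h2; unfold fb; simp; split_ifs <;> simp
  by_cases h3 : p = 2 ∧ w ≤ 8
  · unfold fb; rw [if_neg (by omega), if_neg h2, if_pos h3]; omega
  · rw [fb_gen (by omega) h2 h3, le_hb (by omega)]
    have : 1 ≤ w ^ 9 := Nat.one_le_pow _ _ (by omega)
    omega

lemma fb_ge_three {p w D : ℕ} (hD : 2 ≤ D) (hw : D ≤ w) (h2D : p = 2 → 2 * D ≤ w) : 3 ≤ fb p w := by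
  by_cases h2 : w = 2
  · subst h2; unfold fb; simp; split_ifs <;> omega
  by_cases h3 : p = 2 ∧ w ≤ 8
  · unfold fb; rw [if_neg (by omega), if_neg h2, if_pos h3]; omega
  · rw [fb_gen (by omega) h2 h3, le_hb (by omega)]
    have : 1 ≤ w ^ 9 := Nat.one_le_pow _ _ (by omega)
    omega

lemma sqle {x y : ℕ} (h : x ^ 2 ≤ y ^ 2) : x ≤ y := (Nat.pow_le_pow_iff_left (by norm_num)).1 h

lemma fb_prim_gen {q a w : ℕ} (hw : 3 ≤ w) (hq : 2 ≤ q) (ha : 0 < a) (h : q ^ a ≤ w ^ 2) :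
    2 ^ (5 * fb q a) ≤ w ^ 9 * 2 ^ 13 := by
  by_cases h1 : a = 1
  · subst h1
    calc 2 ^ (5 * fb q 1) ≤ 2 ^ (5 * 1) := by
            gcongr
            · norm_num
            · exact fb_one q
      _ ≤ 3 ^ 9 * 2 ^ 13 := by norm_num
      _ ≤ _ := by gcongr
  by_cases h2 : a = 2
  · subst h2
    calc 2 ^ (5 * fb q 2) ≤ 2 ^ (5 * 4) := by
            gcongr
            exact fb_two q
      _ ≤ 3 ^ 9 * 2 ^ 13 := by norm_num
      _ ≤ _ := by gcongr
  have key : 5 * a ^ 2 ≤ q ^ a → 2 ^ (5 * fb q a) ≤ w ^ 9 * 2 ^ 13 := by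
    intro hk
    refine (fb_pow q a ha).trans ?_
    have : a ^ 9 * 2 ^ 10 ≤ w ^ 9 := by
      apply sqle
      calc (a ^ 9 * 2 ^ 10) ^ 2 = (a ^ 2) ^ 9 * 2 ^ 20 := by ring
        _ ≤ (a ^ 2) ^ 9 * 5 ^ 9 := Nat.mul_le_mul_left _ (by norm_num)
        _ = (5 * a ^ 2) ^ 9 := by ring
        _ ≤ (w ^ 2) ^ 9 := by gcongr; exact hk.trans h
        _ = (w ^ 9) ^ 2 := by ring
    calc a ^ 9 * 2 ^ 23 = (a ^ 9 * 2 ^ 10) * 2 ^ 13 := by ring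
      _ ≤ _ := Nat.mul_le_mul_right _ this
  by_cases hq2 : q = 2
  · subst hq2
    by_cases h8 : a ≤ 8
    · calc 2 ^ (5 * fb 2 a) ≤ 2 ^ (5 * a) := by
            gcongr
            · norm_num
            · exact fb_two_small h8
        _ ≤ _ := by
          apply sqle
          calc (2 ^ (5 * a)) ^ 2 = (2 ^ a) ^ 9 * 2 ^ a := by ring
            _ ≤ (w ^ 2) ^ 9 * 2 ^ 26 := by gcongr; norm_num; omega
            _ = _ := by ring
    · exact key (aux3 a (by omega))
  · have h3 : 3 ≤ q := by omega
    by_cases ha3 : a = 3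
    · subst ha3
      have : 3 ^ 3 ≤ w ^ 2 := le_trans (Nat.pow_le_pow_left h3 3) h
      have hw6 : 6 ≤ w := by nlinarith
      have : fb q 3 ≤ 7 := by
        have := fb_pow q 3 (by norm_num)
        by_contra hc
        have h8 : 2 ^ (5 * 8) ≤ 2 ^ (5 * fb q 3) := Nat.pow_le_pow_right (by norm_num) (by omega)
        norm_num at *
        omega
      calc 2 ^ (5 * fb q 3) ≤ 2 ^ (5 * 7) := by
            gcongr
            norm_num
        _ ≤ 6 ^ 9 * 2 ^ 13 := by norm_num
        _ ≤ _ := by gcongr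
    · exact key ((aux4 a (by omega)).trans (Nat.pow_le_pow_left h3 a))

lemma fb_prim {p q a w D : ℕ} (hD : 2 ≤ D) (hw : D ≤ w) (h2D : p = 2 → 2 * D ≤ w)
    (hq : 2 ≤ q) (ha : 0 < a) (h : q ^ a ≤ D ^ 2) : fb q a + 2 ≤ fb p w := by
  have hpw : q ^ a ≤ w ^ 2 := h.trans (Nat.pow_le_pow_left hw 2)
  have h2a : 2 ^ a ≤ D ^ 2 := (Nat.pow_le_pow_left hq a).trans h
  have small : D ≤ 4 → fb q a ≤ D ∨ (3 ≤ D ∧ fb q a ≤ 4) := by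
    intro hD4
    have ha4 : a ≤ 4 := by
      by_contra hc
      have : 2 ^ 5 ≤ 2 ^ a := Nat.pow_le_pow_right (by norm_num) (by omega)
      nlinarith
    by_cases hq2 : q = 2
    · subst hq2
      have := fb_two_small (w := a) (by omega)
      have : a ≤ D ∨ 3 ≤ D := by
        by_contra hc
        push Not at hc
        have : D = 2 := by omega
        subst this
        have : 2 ^ 3 ≤ 2 ^ a := Nat.pow_le_pow_right (by norm_num) (by omega)
        omega
      omega
    · have h3a : 3 ^ a ≤ D ^ 2 := (Nat.pow_le_pow_left (by omega : 3 ≤ q) a).trans h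
      have ha2 : a ≤ 2 := by
        by_contra hc
        have : 3 ^ 3 ≤ 3 ^ a := Nat.pow_le_pow_right (by norm_num) (by omega)
        nlinarith
      have h1 := fb_one q
      have h2 := fb_two q
      have : a = 1 ∨ a = 2 := by omega
      rcases this with rfl | rfl
      · left; omega
      · right; refine ⟨?_, h2⟩; nlinarith
  by_cases h2 : w = 2
  · subst h2
    have hp : p ≠ 2 := by intro hp; have := h2D hp; omega
    have : fb p 2 = 4 := by unfold fb; simp [hp]
    have := small (by omega)
    omega
  by_cases h3 : p = 2 ∧ w ≤ 8
  · have hR : fb p w = w := by unfold fb; rw [if_neg (by omega), if_neg h2, if_pos h3]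
    have := h2D h3.1
    have := small (by omega)
    omega
  · rw [fb_gen (by omega) h2 h3, le_hb (by omega), mul_add, pow_add]
    have := fb_prim_gen (by omega) hq ha hpw
    omega

end DL

set_option linter.style.haveILetI false

namespace DL
universe u

/-- irreducibility of an action on an abelian group -/
def Irr {H V : Type*} [Group H] [AddCommGroup V] (ρ : H →* AddMonoid.End V) : Prop :=
  ∀ U : AddSubgroup V, (∀ h, ∀ v ∈ U, ρ h v ∈ U) → U = ⊥ ∨ U = ⊤

def Lin (n : ℕ) : Prop :=
  ∀ (H V : Type u) [Group H] [Finite H] [Group.IsSolvable H] [AddCommGroup V] [Finite V]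
    (ρ : H →* AddMonoid.End V), Irr ρ → ∀ p w, p.Prime → 0 < w → Nat.card V = p ^ w → p ^ w = n →
    ∀ h ∈ derivedSeries H (fb p w), ρ h = 1

def Per (n : ℕ) : Prop :=
  ∀ (H : Type u) [Group H] [Finite H] [Group.IsSolvable H] (S : Subgroup H), S.index = n →
    derivedSeries H (gb n) ≤ S

lemma Irr.card {H V : Type*} [Group H] [AddCommGroup V] [Finite V] [Nontrivial V]
    {ρ : H →* AddMonoid.End V} (hρ : Irr ρ) : ∃ p w, p.Prime ∧ 0 < w ∧ Nat.card V = p ^ w := by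
  have hc : 1 < Nat.card V := Finite.one_lt_card
  set p := (Nat.card V).minFac with hp
  have hpp : p.Prime := Nat.minFac_prime (by omega)
  have : Fact p.Prime := ⟨hpp⟩
  have hall : ∀ v : V, p • v = 0 := by
    rcases hρ (nsmulAddMonoidHom (α := V) p).ker (by
      intro h v hv
      rw [AddMonoidHom.mem_ker] at *
      simp only [nsmulAddMonoidHom_apply] at *
      rw [← map_nsmul, hv, map_zero]) with h | h
    · exfalso
      obtain ⟨x, hx⟩ := exists_prime_addOrderOf_dvd_card' (G := V) p (Nat.minFac_dvd _)
      have : x ∈ (nsmulAddMonoidHom (α := V) p).ker := by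
        rw [AddMonoidHom.mem_ker, nsmulAddMonoidHom_apply, ← hx, addOrderOf_nsmul_eq_zero]
      rw [h, AddSubgroup.mem_bot] at this
      subst this
      rw [addOrderOf_zero] at hx
      exact hpp.one_lt.ne hx
    · intro v
      have : v ∈ (nsmulAddMonoidHom (α := V) p).ker := by rw [h]; trivial
      rwa [AddMonoidHom.mem_ker, nsmulAddMonoidHom_apply] at this
  have : Nat.card V = p ^ (Nat.card V).primeFactorsList.length := by
    apply Nat.eq_prime_pow_of_unique_prime_dvd (by omega)
    intro d hd hdv
    have : Fact d.Prime := ⟨hd⟩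
    obtain ⟨x, hx⟩ := exists_prime_addOrderOf_dvd_card' (G := V) d hdv
    have := addOrderOf_dvd_of_nsmul_eq_zero (hall x)
    rw [hx] at this
    exact (Nat.prime_dvd_prime_iff_eq hd hpp).1 this
  refine ⟨p, _, hpp, ?_, this⟩
  rcases Nat.eq_zero_or_pos (Nat.card V).primeFactorsList.length with h | h
  · rw [h, pow_zero] at this; omega
  · exact h

structure Chief {G : Type*} [Group G] (N M : Subgroup G) : Prop where
  nN : N.Normal
  nM : M.Normal
  lt : N < M
  min : ∀ L : Subgroup G, L.Normal → N ≤ L → L ≤ M → L = N ∨ L = M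

lemma chief_bot_comm {G : Type*} [Group G] [Group.IsSolvable G] {M : Subgroup G} (h : Chief ⊥ M) :
    ⁅M, M⁆ = ⊥ := by
  have := h.nM
  rcases h.min ⁅M, M⁆ inferInstance bot_le (Subgroup.commutator_le_left M M) with h1 | h1
  · exact h1
  · exfalso
    obtain ⟨n, hn⟩ := (Group.isSolvable_def G).1 inferInstance
    have : ∀ i, M ≤ derivedSeries G i := by
      intro i
      induction i with
      | zero => simp
      | succ i ih =>
        rw [derivedSeries_succ, ← h1]
        exact Subgroup.commutator_mono ih ih
    have h2 := this n
    rw [hn] at h2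
    exact absurd h.lt (not_lt_of_ge h2)

lemma chief_bot {G : Type u} [Group G] [Finite G] [Group.IsSolvable G] {M : Subgroup G} (h : Chief ⊥ M) :
    ∃ q a, q.Prime ∧ 0 < a ∧ Nat.card M = q ^ a ∧
      (Lin.{u} (q ^ a) → ⁅derivedSeries G (fb q a), M⁆ = ⊥) := by
  have := h.nM
  have hcomm : ∀ x y : M, x * y = y * x := by
    intro x y
    have := Subgroup.commutator_eq_bot_iff_le_centralizer.1 (chief_bot_comm h)
    ext
    exact (Subgroup.mem_centralizer_iff.1 (this x.2) y y.2).symm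
  letI : CommGroup M := { (inferInstance : Group M) with mul_comm := hcomm }
  let ρ : G →* AddMonoid.End (Additive M) :=
    { toFun := fun g => MonoidHom.toAdditive (MulAut.conjNormal g : MulAut M).toMonoidHom
      map_one' := by ext v; simp; rfl
      map_mul' := by intro x y; ext v; simp only [map_mul]; rfl }
  have hρ : ∀ g (v : M), ρ g (Additive.ofMul v) = Additive.ofMul (MulAut.conjNormal g v) := by
    intro g v; rfl
  have hirr : Irr ρ := by
    intro U hU
    let U' : Subgroup G := (AddSubgroup.toSubgroup' U).map M.subtype
    have hmem : ∀ v : M, (v : G) ∈ U' ↔ Additive.ofMul v ∈ U := by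
      intro v
      constructor
      · rintro ⟨y, hy, hyv⟩
        have : y = v := Subtype.ext hyv
        subst this
        exact hy
      · intro hv
        exact ⟨v, hv, rfl⟩
    have hle : U' ≤ M := by
      rintro _ ⟨y, _, rfl⟩
      exact y.2
    have hnorm : U'.Normal := by
      refine ⟨?_⟩
      intro n hn g
      have h1 := hU g (Additive.ofMul ⟨n, hle hn⟩) ((hmem ⟨n, hle hn⟩).1 hn)
      rw [hρ] at h1
      have := (hmem _).2 h1
      simpa using this
    rcases h.min U' hnorm bot_le hle with h1 | h1
    · left
      rw [eq_bot_iff]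
      intro v hv
      have := (hmem (Additive.toMul v)).2 hv
      rw [h1, Subgroup.mem_bot] at this
      have h2 : Additive.toMul v = 1 := Subtype.ext this
      rw [AddSubgroup.mem_bot]
      exact h2
    · right
      rw [eq_top_iff]
      intro v _
      apply (hmem (Additive.toMul v)).1
      rw [h1]
      exact (Additive.toMul v).2
  haveI : Nontrivial M := by
    rw [Subgroup.nontrivial_iff_ne_bot]; exact h.lt.ne'
  obtain ⟨q, a, hq, ha, hc⟩ := hirr.card
  refine ⟨q, a, hq, ha, hc, ?_⟩
  intro hL
  have h2 := hL G (Additive M) ρ hirr q a hq ha hc rfl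
  rw [Subgroup.commutator_eq_bot_iff_le_centralizer]
  intro g hg
  rw [Subgroup.mem_centralizer_iff]
  intro m hm
  have h3 : ρ g (Additive.ofMul ⟨m, hm⟩) = Additive.ofMul ⟨m, hm⟩ := by rw [h2 g hg]; rfl
  rw [hρ] at h3
  have h4 : g * m * g⁻¹ = m := by
    have := congrArg (fun z => ((Additive.toMul z : M) : G)) h3
    simpa using this
  calc m * g = (g * m * g⁻¹) * g := by rw [h4]
    _ = g * m := by group

lemma chief_map {G : Type*} [Group G] {N M : Subgroup G} [N.Normal] (h : Chief N M) :
    Chief ⊥ (M.map (QuotientGroup.mk' N)) := by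
  have := h.nM
  have hs := QuotientGroup.mk'_surjective N
  refine ⟨inferInstance, Subgroup.Normal.map h.nM _ hs, ?_, ?_⟩
  · rw [bot_lt_iff_ne_bot]
    intro h1
    rw [Subgroup.map_eq_bot_iff, QuotientGroup.ker_mk'] at h1
    exact absurd h.lt (not_lt_of_ge h1)
  · intro L hL _ hLM
    have hN : N ≤ L.comap (QuotientGroup.mk' N) := by
      intro x hx
      have : QuotientGroup.mk' N x = 1 := (QuotientGroup.eq_one_iff x).2 hx
      rw [Subgroup.mem_comap, this]
      exact L.one_mem
    have hM : L.comap (QuotientGroup.mk' N) ≤ M := by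
      have := Subgroup.comap_mono (f := QuotientGroup.mk' N) hLM
      rw [Subgroup.comap_map_eq, QuotientGroup.ker_mk', sup_eq_left.2 h.lt.le] at this
      exact this
    have hm : (L.comap (QuotientGroup.mk' N)).map (QuotientGroup.mk' N) = L :=
      Subgroup.map_comap_eq_self_of_surjective hs L
    rcases h.min _ (hL.comap _) hN hM with h1 | h1
    · left; rw [← hm, h1]; simp
    · right; rw [← hm, h1]

lemma chief_main {G : Type u} [Group G] [Finite G] [Group.IsSolvable G] {N M : Subgroup G}
    (h : Chief N M) : ⁅M, M⁆ ≤ N ∧ ∃ q a, q.Prime ∧ 0 < a ∧ N.relIndex M = q ^ a ∧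
      (Lin.{u} (q ^ a) → ⁅derivedSeries G (fb q a), M⁆ ≤ N) := by
  have := h.nN
  have hs := QuotientGroup.mk'_surjective N
  have key : ∀ A B : Subgroup G, ⁅A.map (QuotientGroup.mk' N), B.map (QuotientGroup.mk' N)⁆ = ⊥ →
      ⁅A, B⁆ ≤ N := by
    intro A B hAB
    rwa [← Subgroup.map_commutator, Subgroup.map_eq_bot_iff, QuotientGroup.ker_mk'] at hAB
  have hb := chief_map h
  refine ⟨key _ _ (chief_bot_comm hb), ?_⟩
  obtain ⟨q, a, hq, ha, hc, hL⟩ := chief_bot hb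
  refine ⟨q, a, hq, ha, ?_, fun hl => key _ _ ?_⟩
  · rw [← hc]
    have := Subgroup.relIndex_ker (QuotientGroup.mk' N) (K := M)
    rw [QuotientGroup.ker_mk'] at this
    rw [this]
  · rw [map_derivedSeries_eq hs]
    exact hL hl

/-- existence of chief factors on top of `N` inside a normal subgroup `P`. -/
lemma exists_chief_above {G : Type*} [Group G] [Finite G] {N P : Subgroup G} (hN : N.Normal)
    (hP : P.Normal) (h : N < P) : ∃ M, Chief N M ∧ M ≤ P := by
  have hfin : {M : Subgroup G | M.Normal ∧ N < M ∧ M ≤ P}.Finite := Set.toFinite _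
  obtain ⟨M, hM⟩ := hfin.exists_minimal ⟨P, hP, h, le_rfl⟩
  refine ⟨M, ⟨hN, hM.prop.1, hM.prop.2.1, ?_⟩, hM.prop.2.2⟩
  intro L hL h1 h2
  rcases h1.eq_or_lt with h3 | h3
  · exact Or.inl h3.symm
  · exact Or.inr (le_antisymm h2 (hM.le_of_le ⟨hL, h3, h2.trans hM.prop.2.2⟩ h2))

lemma exists_chief_below {G : Type*} [Group G] [Finite G] {P : Subgroup G}
    (hP : P.Normal) (h : P ≠ ⊥) : ∃ N, Chief N P := by
  have hfin : {M : Subgroup G | M.Normal ∧ M < P}.Finite := Set.toFinite _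
  obtain ⟨M, hM⟩ := hfin.exists_maximal ⟨⊥, inferInstance, bot_lt_iff_ne_bot.2 h⟩
  refine ⟨M, hM.prop.1, hP, hM.prop.2, ?_⟩
  intro L hL h1 h2
  rcases h2.eq_or_lt with h3 | h3
  · exact Or.inr h3
  · exact Or.inl (le_antisymm (hM.le_of_ge ⟨hL, h3⟩ h1) h1)

/-- iterating the derived series -/
lemma derived_add_le {G : Type*} [Group G] (S : Subgroup G) (s t : ℕ) (h : derivedSeries G s ≤ S) :
    derivedSeries G (s + t) ≤ (derivedSeries S t).map S.subtype := by
  induction t with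
  | zero => simpa [← MonoidHom.range_eq_map] using h
  | succ t ih =>
    rw [← add_assoc, derivedSeries_succ, derivedSeries_succ, Subgroup.map_commutator]
    exact Subgroup.commutator_mono ih ih

end DL

set_option linter.style.haveILetI false

namespace DL
universe u
open scoped commutatorElement

def cmod {G : Type*} [Group G] (N M : Subgroup G) [N.Normal] : Subgroup G :=
  (Subgroup.centralizer (M.map (QuotientGroup.mk' N) : Set (G ⧸ N))).comap (QuotientGroup.mk' N)

lemma le_cmod {G : Type*} [Group G] {N M A : Subgroup G} [N.Normal] :
    A ≤ cmod N M ↔ ⁅A, M⁆ ≤ N := by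
  unfold cmod
  rw [← Subgroup.map_le_iff_le_comap, ← Subgroup.commutator_eq_bot_iff_le_centralizer,
    ← Subgroup.map_commutator, Subgroup.map_eq_bot_iff, QuotientGroup.ker_mk']

lemma cmod_normal {G : Type*} [Group G] (N M : Subgroup G) [N.Normal] (hM : M.Normal) :
    (cmod N M).Normal := by
  unfold cmod
  haveI : (M.map (QuotientGroup.mk' N)).Normal :=
    Subgroup.Normal.map hM _ (QuotientGroup.mk'_surjective N)
  exact Subgroup.Normal.comap inferInstance _

lemma sup_comm_le {G : Type*} [Group G] {N M A B : Subgroup G} [N.Normal] (h1 : ⁅A, M⁆ ≤ N)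
    (h2 : ⁅B, M⁆ ≤ N) : ⁅A ⊔ B, M⁆ ≤ N :=
  le_cmod.1 (sup_le (le_cmod.2 h1) (le_cmod.2 h2))

lemma per_max_aux {H : Type*} [Group H] {S M X N : Subgroup H} (hN : N = S.normalCore)
    (hX : X.Normal) (hNX : N ≤ X) (hMS : M ⊔ S = ⊤) (hMX : ⁅M, X⁆ ≤ N) : X ⊓ S ≤ N := by
  have hNS : N ≤ S := hN ▸ Subgroup.normalCore_le S
  have hnorm : (X ⊓ S).Normal := by
    rw [← Subgroup.normalizer_eq_top_iff, eq_top_iff, ← hMS]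
    refine sup_le ?_ ?_
    · have key : ∀ m ∈ M, ∀ x ∈ X ⊓ S, m * x * m⁻¹ ∈ X ⊓ S := by
        intro m hm x hx
        have h1 : ⁅m, x⁆ ∈ N := hMX (Subgroup.commutator_mem_commutator hm hx.1)
        have h2 : m * x * m⁻¹ = ⁅m, x⁆ * x := by rw [commutatorElement_def]; group
        rw [h2]
        exact Subgroup.mul_mem _ ⟨hNX h1, hNS h1⟩ hx
      intro m hm
      rw [Subgroup.mem_normalizer_iff]
      intro x
      refine ⟨key m hm x, fun h => ?_⟩
      have := key m⁻¹ (M.inv_mem hm) _ h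
      simpa [mul_assoc] using this
    · intro s hs
      rw [Subgroup.mem_normalizer_iff]
      intro x
      refine ⟨fun h => ⟨hX.conj_mem x h.1 s, S.mul_mem (S.mul_mem hs h.2) (S.inv_mem hs)⟩, fun h => ?_⟩
      refine ⟨?_, ?_⟩
      · have := hX.conj_mem _ h.1 s⁻¹
        simpa [mul_assoc] using this
      · have := S.mul_mem (S.mul_mem (S.inv_mem hs) h.2) hs
        simpa [mul_assoc] using this
  rw [hN]
  exact Subgroup.normal_le_normalCore.2 inf_le_right

lemma per_step (n : ℕ) (hL : ∀ m ≤ n, Lin.{u} m) (hP : ∀ m < n, Per.{u} m) : Per.{u} n := by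
  intro H _ _ _ S hS
  have hn0 : 0 < n := by rw [← hS]; exact Nat.pos_of_ne_zero Subgroup.index_ne_zero_of_finite
  by_cases htop : S = ⊤
  · rw [htop]; exact le_top
  by_cases hT : ∃ T : Subgroup H, S < T ∧ T < ⊤
  · obtain ⟨T, hST, hT⟩ := hT
    have hmul := Subgroup.relIndex_mul_index hST.le
    have h1 : S.relIndex T ≠ 1 := by
      rw [Ne, Subgroup.relIndex_eq_one]; exact not_le_of_gt hST
    have h2 : T.index ≠ 1 := by
      rw [Ne, Subgroup.index_eq_one]; exact hT.ne
    rw [hS] at hmul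
    have h3 : S.relIndex T ≠ 0 := by rintro h; rw [h] at hmul; omega
    have h4 : T.index ≠ 0 := by rintro h; rw [h] at hmul; omega
    have h5 : S.relIndex T < n := by
      have : 2 ≤ T.index := by omega
      nlinarith [Nat.pos_of_ne_zero h3]
    have h6 : T.index < n := by
      have : 2 ≤ S.relIndex T := by omega
      nlinarith [Nat.pos_of_ne_zero h4]
    have hA := hP _ h6 H T rfl
    have hB := hP _ h5 T (S.subgroupOf T) rfl
    have h7 := gb_mul (Nat.pos_of_ne_zero h4) (Nat.pos_of_ne_zero h3)
    rw [mul_comm, hmul] at h7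
    calc derivedSeries H (gb n) ≤ derivedSeries H (gb T.index + gb (S.relIndex T)) :=
          derivedSeries_antitone H h7
      _ ≤ (derivedSeries T (gb (S.relIndex T))).map T.subtype := derived_add_le T _ _ hA
      _ ≤ (S.subgroupOf T).map T.subtype := Subgroup.map_mono hB
      _ ≤ S := by rw [Subgroup.subgroupOf_map_subtype]; exact inf_le_left
  · push Not at hT
    set N := S.normalCore with hN
    haveI hNn : N.Normal := Subgroup.normalCore_normal S
    have hNS : N ≤ S := Subgroup.normalCore_le S
    obtain ⟨M, hM, -⟩ := exists_chief_above hNn (inferInstance : (⊤ : Subgroup H).Normal)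
      (lt_of_le_of_lt hNS (lt_top_iff_ne_top.2 htop))
    haveI := hM.nM
    have hMS : M ⊔ S = ⊤ := by
      by_contra hc
      have h1 : ¬ M ≤ S := by
        intro h
        exact absurd hM.lt (not_lt_of_ge (Subgroup.normal_le_normalCore.2 h))
      have h2 : S < M ⊔ S := by
        refine lt_of_le_of_ne le_sup_right ?_
        intro h
        exact h1 (h ▸ le_sup_left)
      exact hT _ h2 (lt_top_iff_ne_top.2 hc)
    obtain ⟨hMM, q, a, hq, ha, hidx, hlin⟩ := chief_main hM
    have hMSN : M ⊓ S = N :=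
      le_antisymm (per_max_aux hN hM.nM hM.lt.le hMS hMM) (le_inf hM.lt.le hNS)
    have hna : n = q ^ a := by
      have e1 : M.index = N.relIndex S := by
        rw [← Subgroup.relIndex_top_right, ← hMS, Subgroup.relIndex_sup_left,
          ← Subgroup.inf_relIndex_right, hMSN]
      have e2 := Subgroup.relIndex_mul_index hNS
      have e3 := Subgroup.relIndex_mul_index hM.lt.le
      rw [← e3, ← e1, mul_comm] at e2
      have := Nat.eq_of_mul_eq_mul_right
        (Nat.pos_of_ne_zero (Subgroup.index_ne_zero_of_finite (H := M))) e2
      rw [← hS, this, hidx]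
    have hD := hlin (hL _ hna.ge)
    have hX : (cmod N M).Normal := cmod_normal N M hM.nM
    have hMX : M ≤ cmod N M := le_cmod.2 hMM
    have hXS : cmod N M ⊓ S ≤ N := by
      refine per_max_aux hN hX (hM.lt.le.trans hMX) hMS ?_
      rw [Subgroup.commutator_comm]
      exact le_cmod.1 le_rfl
    have hXM : cmod N M ≤ M := by
      intro x hx
      have : x ∈ M ⊔ S := by rw [hMS]; trivial
      rw [Subgroup.mem_sup_of_normal_left] at this
      obtain ⟨m, hm, s, hs, rfl⟩ := this
      have : s ∈ cmod N M := by
        have := (cmod N M).mul_mem ((cmod N M).inv_mem (hMX hm)) hx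
        simpa using this
      exact M.mul_mem hm (hM.lt.le (hXS ⟨this, hs⟩))
    have hDM : derivedSeries H (fb q a) ≤ M := (le_cmod.2 hD).trans hXM
    calc derivedSeries H (gb n) ≤ derivedSeries H (fb q a + 1) :=
          derivedSeries_antitone H (by rw [hna]; exact fb_prim_perm hq.two_le ha)
      _ ≤ ⁅M, M⁆ := by rw [derivedSeries_succ]; exact Subgroup.commutator_mono hDM hDM
      _ ≤ S := hMM.trans hNS

end DL

set_option linter.style.haveILetI false

namespace DL
universe u
open scoped commutatorElement

section
variable {H V : Type u} [Group H] [AddCommGroup V] (ρ : H →* AddMonoid.End V)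

lemma rho_inv_mul (h : H) : ρ h⁻¹ * ρ h = 1 := by rw [← map_mul]; simp
lemma rho_mul_inv (h : H) : ρ h * ρ h⁻¹ = 1 := by rw [← map_mul]; simp

/-- a normal subgroup with a nonzero fixed vector acts trivially. -/
lemma trivial_of_fixed {ρ : H →* AddMonoid.End V} (hρ : Irr ρ) (N : Subgroup H) (hN : N.Normal)
    (v : V) (hv : v ≠ 0) (h : ∀ n ∈ N, ρ n v = v) : ∀ n ∈ N, ρ n = 1 := by
  let U : AddSubgroup V :=
    { carrier := {v | ∀ n ∈ N, ρ n v = v}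
      zero_mem' := by intro n _; simp
      add_mem' := by intro a b ha hb n hn; rw [map_add, ha n hn, hb n hn]
      neg_mem' := by intro a ha n hn; rw [map_neg, ha n hn] }
  have hU : U = ⊤ := by
    rcases hρ U (by
      intro g v hv n hn
      have h1 := hv (g⁻¹ * n * g) (by simpa using hN.conj_mem n hn g⁻¹)
      have h2 : n * g = g * (g⁻¹ * n * g) := by group
      calc ρ n (ρ g v) = ρ (n * g) v := by rw [map_mul]; rfl
        _ = ρ g (ρ (g⁻¹ * n * g) v) := by rw [h2, map_mul]; rfl
        _ = _ := by rw [h1]) with h1 | h1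
    · exfalso
      have : v ∈ U := h
      rw [h1] at this
      exact hv this
    · exact h1
  intro n hn
  ext x
  have : x ∈ U := by rw [hU]; trivial
  exact this n hn

def cj (e : AddMonoid.End V) (h : H) : AddMonoid.End V := ρ h * e * ρ h⁻¹

lemma cj_mul (e : AddMonoid.End V) (g h : H) : cj ρ e (g * h) = ρ g * cj ρ e h * ρ g⁻¹ := by
  unfold cj; simp only [map_mul, mul_inv_rev, mul_assoc]

def stab (e : AddMonoid.End V) : Subgroup H where
  carrier := {h | cj ρ e h = e}
  one_mem' := by simp [cj]
  mul_mem' := by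
    intro a b ha hb
    simp only [Set.mem_ofPred_eq] at *
    rw [cj_mul, hb]; exact ha
  inv_mem' := by
    intro a ha
    simp only [Set.mem_ofPred_eq] at *
    have : cj ρ e (a⁻¹ * a) = e := by simp [cj]
    rwa [cj_mul, ha] at this

lemma mem_stab {e : AddMonoid.End V} {h : H} : h ∈ stab ρ e ↔ cj ρ e h = e := Iff.rfl

lemma stab_comm {e : AddMonoid.End V} {h : H} (hh : h ∈ stab ρ e) : ρ h * e = e * ρ h := by
  have := mem_stab ρ |>.1 hh
  calc ρ h * e = ρ h * e * (ρ h⁻¹ * ρ h) := by rw [rho_inv_mul, mul_one]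
    _ = cj ρ e h * ρ h := by unfold cj; simp only [mul_assoc]
    _ = _ := by rw [this]

variable {ρ} {e : AddMonoid.End V}

lemma cj_eq {g h : H} (hh : g⁻¹ * h ∈ stab ρ e) : cj ρ e h = cj ρ e g := by
  have : h = g * (g⁻¹ * h) := by group
  rw [this, cj_mul, (mem_stab ρ).1 hh]; rfl

lemma cj_orth (ho : ∀ h, cj ρ e h = e ∨ e * cj ρ e h = 0) {g h : H} (hh : g⁻¹ * h ∉ stab ρ e) :
    cj ρ e g * cj ρ e h = 0 := by
  have h1 : e * cj ρ e (g⁻¹ * h) = 0 := (ho _).resolve_left hh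
  have : h = g * (g⁻¹ * h) := by group
  rw [this, cj_mul]
  calc cj ρ e g * (ρ g * cj ρ e (g⁻¹ * h) * ρ g⁻¹)
      = ρ g * e * (ρ g⁻¹ * ρ g) * cj ρ e (g⁻¹ * h) * ρ g⁻¹ := by
        unfold cj; simp only [mul_assoc]
    _ = ρ g * (e * cj ρ e (g⁻¹ * h)) * ρ g⁻¹ := by rw [rho_inv_mul, mul_one]; simp only [mul_assoc]
    _ = 0 := by rw [h1]; simp

lemma cj_idem (he : e * e = e) (g : H) : cj ρ e g * cj ρ e g = cj ρ e g := by
  calc cj ρ e g * cj ρ e g = ρ g * e * (ρ g⁻¹ * ρ g) * e * ρ g⁻¹ := by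
        unfold cj; simp only [mul_assoc]
    _ = ρ g * (e * e) * ρ g⁻¹ := by rw [rho_inv_mul, mul_one]; simp only [mul_assoc]
    _ = _ := by rw [he]; rfl

lemma sum_cj [Finite H] [Fintype (H ⧸ stab ρ e)] (hρ : Irr ρ) (he : e * e = e) (he0 : e ≠ 0)
    (ho : ∀ h, cj ρ e h = e ∨ e * cj ρ e h = 0) :
    ∑ x : H ⧸ stab ρ e, cj ρ e x.out = 1 := by
  classical
  set T := ∑ x : H ⧸ stab ρ e, cj ρ e x.out with hT
  have hcoset : ∀ h : H, cj ρ e (h : H ⧸ stab ρ e).out = cj ρ e h := by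
    intro h
    apply cj_eq
    rw [← QuotientGroup.eq]; simp
  have hcomm : ∀ g, ρ g * T = T * ρ g := by
    intro g
    have h1 : ρ g * T * ρ g⁻¹ = T := by
      rw [hT, Finset.mul_sum, Finset.sum_mul]
      refine Fintype.sum_equiv (MulAction.toPerm g) _ _ ?_
      intro x
      rw [← cj_mul, MulAction.toPerm_apply]
      have : g • x = ((g * x.out : H) : H ⧸ stab ρ e) := by
        conv_lhs => rw [← QuotientGroup.out_eq' x]
        rfl
      rw [this, hcoset]
    calc ρ g * T = ρ g * T * (ρ g⁻¹ * ρ g) := by rw [rho_inv_mul, mul_one]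
      _ = ρ g * T * ρ g⁻¹ * ρ g := by simp only [mul_assoc]
      _ = _ := by rw [h1]
  have hTe : T * e = e := by
    rw [hT, Finset.sum_mul, Finset.sum_eq_single ((1 : H) : H ⧸ stab ρ e)]
    · rw [hcoset]; simp [cj, he]
    · intro x _ hx
      have h1 : cj ρ e x.out * cj ρ e 1 = 0 := by
        apply cj_orth ho
        rw [← QuotientGroup.eq, QuotientGroup.out_eq']
        exact hx
      simpa [cj] using h1
    · simp
  have hU := hρ ((T - 1 : AddMonoid.End V)).ker (by
    intro g v hv
    change (T - 1) v = 0 at hv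
    change (T - 1) (ρ g v) = 0
    have : (T - 1) * ρ g = ρ g * (T - 1) := by rw [sub_mul, mul_sub, hcomm]; simp
    calc (T - 1) (ρ g v) = ((T - 1) * ρ g) v := rfl
      _ = ρ g ((T - 1) v) := by rw [this]; rfl
      _ = 0 := by rw [hv, map_zero])
  have : ((T - 1 : AddMonoid.End V)).ker = ⊤ := by
    refine hU.resolve_left ?_
    intro hb
    apply he0
    ext v
    have : e v ∈ ((T - 1 : AddMonoid.End V)).ker := by
      change (T - 1) (e v) = 0
      calc (T - 1) (e v) = (T * e - e) v := rfl
        _ = 0 := by rw [hTe, sub_self]; rfl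
    rw [hb] at this
    exact this
  have h2 : T - 1 = 0 := by
    ext v
    have : v ∈ ((T - 1 : AddMonoid.End V)).ker := by rw [this]; trivial
    exact this
  exact sub_eq_zero.1 h2

lemma end_sum_apply {ι : Type*} (s : Finset ι) (f : ι → AddMonoid.End V) (v : V) :
    (∑ x ∈ s, f x) v = ∑ x ∈ s, f x v := by
  classical
  induction s using Finset.induction_on with
  | empty => rfl
  | insert a s ha ih =>
    rw [Finset.sum_insert ha, Finset.sum_insert ha, ← ih]; rfl

lemma card_imprim [Finite H] [Finite V] (hρ : Irr ρ) (he : e * e = e) (he0 : e ≠ 0)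
    (ho : ∀ h, cj ρ e h = e ∨ e * cj ρ e h = 0) :
    Nat.card V = Nat.card (AddMonoidHom.range e) ^ (stab ρ e).index := by
  classical
  haveI : Fintype (H ⧸ stab ρ e) := Fintype.ofFinite _
  have hs := sum_cj hρ he he0 ho
  have hfix : ∀ z : AddMonoidHom.range e, e z = z := by
    rintro ⟨_, v, rfl⟩
    calc e (e v) = (e * e) v := rfl
      _ = e v := by rw [he]
  let Φ : V ≃ (H ⧸ stab ρ e → AddMonoidHom.range e) :=
    { toFun := fun v x => ⟨e (ρ x.out⁻¹ v), _, rfl⟩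
      invFun := fun f => ∑ x, ρ x.out (f x)
      left_inv := by
        intro v
        have := congrArg (fun T : AddMonoid.End V => T v) hs
        simp only [AddMonoid.End.coe_one, id] at this
        rw [end_sum_apply] at this
        exact this
      right_inv := by
        intro f
        funext y
        ext
        simp only
        rw [map_sum, map_sum, Finset.sum_eq_single y]
        · calc e (ρ y.out⁻¹ (ρ y.out (f y))) = e ((ρ y.out⁻¹ * ρ y.out) (f y)) := rfl
            _ = f y := by rw [rho_inv_mul]; exact hfix _
        · intro x _ hx
          have h1 : e * cj ρ e (y.out⁻¹ * x.out) = 0 := by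
            refine (ho _).resolve_left ?_
            intro h
            have : y.out⁻¹ * x.out ∈ stab ρ e := h
            rw [← QuotientGroup.eq, QuotientGroup.out_eq', QuotientGroup.out_eq'] at this
            exact hx this.symm
          calc e (ρ y.out⁻¹ (ρ x.out (f x))) = e (ρ y.out⁻¹ (ρ x.out (e (f x)))) := by rw [hfix]
            _ = (e * (ρ y.out⁻¹ * ρ x.out) * e) (f x) := rfl
            _ = (e * cj ρ e (y.out⁻¹ * x.out) * ρ (y.out⁻¹ * x.out)) (f x) := by
              congr 1
              unfold cj
              rw [← map_mul]
              simp only [mul_assoc]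
              rw [rho_inv_mul, mul_one]
            _ = 0 := by rw [h1, zero_mul]; rfl
        · simp }
  rw [Nat.card_congr Φ, Nat.card_fun, Subgroup.index]

/-- restriction of the action of the stabilizer. -/
def resS (ρ : H →* AddMonoid.End V) (e : AddMonoid.End V) :
    stab ρ e →* AddMonoid.End (AddMonoidHom.range e) where
  toFun s := ((ρ (s : H)).comp (AddMonoidHom.range e).subtype).codRestrict (AddMonoidHom.range e) (by
    rintro ⟨_, v, rfl⟩
    refine ⟨ρ (s : H) v, ?_⟩
    calc e (ρ (s : H) v) = (e * ρ (s : H)) v := rfl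
      _ = (ρ (s : H) * e) v := by rw [stab_comm ρ s.2])
  map_one' := by
    ext v
    change ρ 1 (v : V) = v
    rw [map_one]; rfl
  map_mul' := by
    intro x y
    ext v
    change ρ ((x : H) * y) (v : V) = ρ (x : H) (ρ (y : H) v)
    rw [map_mul]; rfl

lemma resS_apply (s : stab ρ e) (v : AddMonoidHom.range e) : (resS ρ e s v : V) = ρ (s : H) v := rfl

lemma irr_resS (hρ : Irr ρ) (he : e * e = e)
    (ho : ∀ h, cj ρ e h = e ∨ e * cj ρ e h = 0) : Irr (resS ρ e) := by
  intro U hU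
  set U0 := U.map (AddMonoidHom.range e).subtype with hU0
  have hfix : ∀ z : AddMonoidHom.range e, e z = z := by
    rintro ⟨_, v, rfl⟩
    calc e (e v) = (e * e) v := rfl
      _ = e v := by rw [he]
  have hmem : ∀ z : AddMonoidHom.range e, (z : V) ∈ U0 ↔ z ∈ U := by
    intro z
    constructor
    · rintro ⟨y, hy, hyz⟩
      have : y = z := Subtype.ext hyz
      rwa [← this]
    · intro hz; exact ⟨z, hz, rfl⟩
  rcases hρ (⨆ h : H, U0.map (ρ h)) (by
    intro g v hv
    have h1 : ρ g v ∈ (⨆ h : H, U0.map (ρ h)).map (ρ g) := ⟨v, hv, rfl⟩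
    have h1 := (AddSubgroup.map_iSup _ _).le h1
    refine (iSup_le ?_ : (⨆ h, (U0.map (ρ h)).map (ρ g)) ≤ ⨆ h : H, U0.map (ρ h)) h1
    intro h
    rintro _ ⟨_, ⟨u, hu, rfl⟩, rfl⟩
    refine le_iSup (fun h : H => U0.map (ρ h)) (g * h) ⟨u, hu, ?_⟩
    rw [map_mul]; rfl) with h1 | h1
  · left
    rw [eq_bot_iff]
    intro z hz
    have h2 : (z : V) ∈ ⨆ h : H, U0.map (ρ h) := by
      refine (le_iSup (fun h : H => U0.map (ρ h)) 1) ?_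
      exact ⟨z, (hmem z).2 hz, by rw [map_one]; rfl⟩
    rw [h1, AddSubgroup.mem_bot] at h2
    rw [AddSubgroup.mem_bot]
    exact Subtype.ext h2
  · right
    rw [eq_top_iff]
    intro z _
    have h2 : (z : V) ∈ (⨆ h : H, U0.map (ρ h)).map e := by
      rw [h1]; exact ⟨z, trivial, hfix z⟩
    have h2 := (AddSubgroup.map_iSup _ _).le h2
    rw [← hmem]
    refine (iSup_le ?_ : (⨆ h, (U0.map (ρ h)).map e) ≤ U0) h2
    rintro h _ ⟨_, ⟨_, ⟨u, hu, rfl⟩, rfl⟩, rfl⟩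
    by_cases hh : h ∈ stab ρ e
    · have h3 := hU ⟨h, hh⟩ u hu
      have h4 : e (ρ h (u : V)) = ((resS ρ e ⟨h, hh⟩ u : AddMonoidHom.range e) : V) := by
        rw [← hfix (resS ρ e ⟨h, hh⟩ u)]; rfl
      change e (ρ h (u : V)) ∈ U0
      rw [h4, hmem]; exact h3
    · have h3 : e * cj ρ e h = 0 := (ho h).resolve_left hh
      have h4 : e (ρ h (u : V)) = 0 := by
        calc e (ρ h (u : V)) = e (ρ h (e u)) := by rw [hfix]
          _ = (e * ρ h * e) u := rfl
          _ = (e * cj ρ e h * ρ h) u := by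
            congr 1
            unfold cj
            simp only [mul_assoc]
            rw [rho_inv_mul, mul_one]
          _ = 0 := by rw [h3, zero_mul]; rfl
      change e (ρ h (u : V)) ∈ U0
      rw [h4]; exact U0.zero_mem

lemma imprim [Finite H] [Group.IsSolvable H] [Finite V] (hρ : Irr ρ) {p w : ℕ} (hp : p.Prime)
    (hc : Nat.card V = p ^ w) (hL : ∀ m < p ^ w, Lin.{u} m) (hP : ∀ m < p ^ w, Per.{u} m)
    (he : e * e = e) (he0 : e ≠ 0) (he1 : e ≠ 1)
    (ho : ∀ h, cj ρ e h = e ∨ e * cj ρ e h = 0) : ∀ h ∈ derivedSeries H (fb p w), ρ h = 1 := by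
  have hcard := card_imprim hρ he he0 ho
  set k := (stab ρ e).index with hk
  have hk0 : k ≠ 0 := Subgroup.index_ne_zero_of_finite
  have hk1 : k ≠ 1 := by
    intro h
    rw [hk, Subgroup.index_eq_one] at h
    have hr := hρ (AddMonoidHom.range e) (by
      rintro g _ ⟨v, rfl⟩
      refine ⟨ρ g v, ?_⟩
      have : g ∈ stab ρ e := by rw [h]; trivial
      calc e (ρ g v) = (e * ρ g) v := rfl
        _ = (ρ g * e) v := by rw [stab_comm ρ this])
    rcases hr with hr | hr
    · apply he0
      ext v
      have : e v ∈ AddMonoidHom.range e := ⟨v, rfl⟩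
      rw [hr] at this
      exact this
    · apply he1
      ext v
      have : v ∈ AddMonoidHom.range e := by rw [hr]; trivial
      obtain ⟨y, rfl⟩ := this
      calc e (e y) = (e * e) y := rfl
        _ = e y := by rw [he]
  obtain ⟨v0, hv0⟩ : ∃ v, e v ≠ 0 := by
    by_contra hcon
    push Not at hcon
    exact he0 (by ext v; exact hcon v)
  haveI : Nontrivial (AddMonoidHom.range e) := ⟨⟨e v0, v0, rfl⟩, 0, fun h => hv0 (congrArg Subtype.val h)⟩
  have hr1 : 1 < Nat.card (AddMonoidHom.range e) := Finite.one_lt_card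
  have hdvd : Nat.card (AddMonoidHom.range e) ∣ p ^ w := by
    rw [← hc, hcard]; exact dvd_pow_self _ hk0
  obtain ⟨a, -, ha⟩ := (Nat.dvd_prime_pow hp).1 hdvd
  have ha0 : 0 < a := by
    rcases Nat.eq_zero_or_pos a with h | h
    · rw [h, pow_zero] at ha; omega
    · exact h
  have hw : w = k * a := by
    rw [hc, ha, ← pow_mul] at hcard
    rw [Nat.pow_right_injective hp.two_le hcard, mul_comm]
  have hkw : k ≤ w := by rw [hw]; exact Nat.le_mul_of_pos_right k ha0
  have haw : a < w := by rw [hw]; nlinarith [Nat.pos_of_ne_zero hk0, show 2 ≤ k by omega]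
  have hD1 := hP k (lt_of_le_of_lt hkw (Nat.lt_pow_self hp.one_lt)) H (stab ρ e) rfl
  have hD2 := hL (p ^ a) (Nat.pow_lt_pow_right hp.one_lt haw) (stab ρ e) (AddMonoidHom.range e)
    (resS ρ e) (irr_resS hρ he ho) p a hp ha0 ha rfl
  have hD := derived_add_le (stab ρ e) (gb k) (fb p a) hD1
  have hfix : ∀ n ∈ derivedSeries H (gb k + fb p a), ρ n (e v0) = e v0 := by
    intro n hn
    obtain ⟨s, hs, rfl⟩ := hD hn
    have := hD2 s hs
    have h2 := resS_apply (ρ := ρ) (e := e) s ⟨e v0, v0, rfl⟩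
    rw [this] at h2
    exact h2.symm
  have hall := trivial_of_fixed hρ _ (derivedSeries_normal H _) (e v0) hv0 hfix
  intro h hh
  refine hall h (derivedSeries_antitone H ?_ hh)
  rw [hw]
  exact fb_imprim p (by omega) ha0

end
end DL

set_option linter.style.haveILetI false

namespace DL
universe u

lemma exists_pow_idem {M : Type*} [Monoid M] [Finite M] (x : M) :
    ∃ n, 0 < n ∧ x ^ n * x ^ n = x ^ n := by
  obtain ⟨i, j, hij, h⟩ := Finite.exists_ne_map_eq_of_infinite (fun n : ℕ => x ^ n)
  wlog hlt : i < j generalizing i j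
  · exact this j i hij.symm h.symm (by omega)
  obtain ⟨k, rfl⟩ := Nat.exists_eq_add_of_lt hlt
  change x ^ i = x ^ (i + k + 1) at h
  have h1 : ∀ t m, x ^ (i + m + (k + 1) * t) = x ^ (i + m) := by
    intro t
    induction t with
    | zero => intro m; simp
    | succ t ih =>
      intro m
      have : i + m + (k + 1) * (t + 1) = (i + k + 1) + (m + (k + 1) * t) := by ring
      rw [this, pow_add, ← h, ← pow_add, ← add_assoc, ih]
  refine ⟨(i + 1) * (k + 1), by positivity, ?_⟩
  rw [← pow_add]
  have h2 := h1 (i + 1) ((i + 1) * (k + 1) - i)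
  have h3 : i + ((i + 1) * (k + 1) - i) = (i + 1) * (k + 1) := by
    have : i ≤ (i + 1) * (k + 1) := by nlinarith
    omega
  rw [h3, mul_comm (k + 1)] at h2
  exact h2

section
variable {H V : Type u} [Group H] [AddCommGroup V] (ρ : H →* AddMonoid.End V)

/-- the ring generated by the image of a subgroup -/
def RA (A : Subgroup H) : Subring (AddMonoid.End V) := Subring.closure (ρ '' A)

lemma RA_mem {A : Subgroup H} {a : H} (ha : a ∈ A) : ρ a ∈ RA ρ A :=
  Subring.subset_closure ⟨a, ha, rfl⟩

lemma RA_comm {A : Subgroup H} (hA : ∀ a ∈ A, ∀ b ∈ A, a * b = b * a) {x y : AddMonoid.End V}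
    (hx : x ∈ RA ρ A) (hy : y ∈ RA ρ A) : x * y = y * x := by
  have h1 : ∀ a ∈ A, ∀ y ∈ RA ρ A, y * ρ a = ρ a * y := by
    intro a ha y hy
    refine Subring.closure_induction (p := fun y _ => y * ρ a = ρ a * y) ?_ ?_ ?_ ?_ ?_ ?_ hy
    · rintro _ ⟨b, hb, rfl⟩
      rw [← map_mul, ← map_mul, hA a ha b hb]
    · simp
    · simp
    · intro x y _ _ h1 h2; rw [add_mul, mul_add, h1, h2]
    · intro x _ h1; rw [neg_mul, mul_neg, h1]
    · intro x y _ _ h1 h2; rw [mul_assoc, h2, ← mul_assoc, h1, mul_assoc]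
  refine Subring.closure_induction (p := fun x _ => x * y = y * x) ?_ ?_ ?_ ?_ ?_ ?_ hx
  · rintro _ ⟨b, hb, rfl⟩
    exact (h1 b hb y hy).symm
  · simp
  · simp
  · intro x z _ _ h1 h2; rw [add_mul, mul_add, h1, h2]
  · intro x _ h1; rw [neg_mul, mul_neg, h1]
  · intro x z _ _ h1 h2; rw [mul_assoc, h2, ← mul_assoc, h1, mul_assoc]

/-- elements commuting with `A` commute with the generated ring. -/
lemma RA_centr {A : Subgroup H} {c : H} (hc : ∀ a ∈ A, a * c = c * a) {x : AddMonoid.End V}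
    (hx : x ∈ RA ρ A) : x * ρ c = ρ c * x := by
  refine Subring.closure_induction (p := fun y _ => y * ρ c = ρ c * y) ?_ ?_ ?_ ?_ ?_ ?_ hx
  · rintro _ ⟨b, hb, rfl⟩
    rw [← map_mul, ← map_mul, hc b hb]
  · simp
  · simp
  · intro x y _ _ h1 h2; rw [add_mul, mul_add, h1, h2]
  · intro x _ h1; rw [neg_mul, mul_neg, h1]
  · intro x y _ _ h1 h2; rw [mul_assoc, h2, ← mul_assoc, h1, mul_assoc]

lemma cj_mul' (x y : AddMonoid.End V) (h : H) : cj ρ (x * y) h = cj ρ x h * cj ρ y h := by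
  calc cj ρ (x * y) h = ρ h * x * 1 * y * ρ h⁻¹ := by unfold cj; simp only [mul_assoc, one_mul]
    _ = _ := by rw [← rho_inv_mul ρ h]; unfold cj; simp only [mul_assoc]

lemma cj_pow (x : AddMonoid.End V) (h : H) (n : ℕ) : cj ρ (x ^ n) h = cj ρ x h ^ n := by
  induction n with
  | zero => simp [cj, rho_mul_inv]
  | succ n ih => rw [pow_succ, pow_succ, cj_mul', ih]

lemma RA_conj {A : Subgroup H} (hN : A.Normal) {x : AddMonoid.End V}
    (hx : x ∈ RA ρ A) (h : H) : cj ρ x h ∈ RA ρ A := by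
  refine Subring.closure_induction (p := fun x _ => cj ρ x h ∈ RA ρ A) ?_ ?_ ?_ ?_ ?_ ?_ hx
  · rintro _ ⟨b, hb, rfl⟩
    unfold cj
    rw [← map_mul, ← map_mul]
    exact RA_mem ρ (hN.conj_mem b hb h)
  · simp [cj, zero_mem]
  · simp [cj, rho_mul_inv, one_mem]
  · intro x y _ _ h1 h2
    have : cj ρ (x + y) h = cj ρ x h + cj ρ y h := by unfold cj; rw [mul_add, add_mul]
    rw [this]; exact add_mem h1 h2
  · intro x _ h1
    have : cj ρ (-x) h = - cj ρ x h := by unfold cj; simp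
    rw [this]; exact neg_mem h1
  · intro x y _ _ h1 h2
    rw [cj_mul']; exact mul_mem h1 h2

variable {ρ}

lemma RA_nil [Finite V] [Nontrivial V] (hρ : Irr ρ) {A : Subgroup H} (hN : A.Normal)
    (hA : ∀ a ∈ A, ∀ b ∈ A, a * b = b * a) {x : AddMonoid.End V}
    (hx : x ∈ RA ρ A) (hn : IsNilpotent x) : x = 0 := by
  let U : AddSubgroup V :=
    { carrier := {v | ∀ x ∈ RA ρ A, IsNilpotent x → x v = 0}
      zero_mem' := by intro n _ _; simp
      add_mem' := by intro a b ha hb n hn h; rw [map_add, ha n hn h, hb n hn h, add_zero]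
      neg_mem' := by intro a ha n hn h; rw [map_neg, ha n hn h, neg_zero] }
  have hmem : ∀ v, v ∈ U ↔ ∀ x ∈ RA ρ A, IsNilpotent x → x v = 0 := fun v => Iff.rfl
  have hU : U = ⊤ := by
    refine (hρ U ?_).resolve_left ?_
    · intro h v hv y hy hyn
      have h1 : cj ρ y h⁻¹ v = 0 := by
        refine hv _ (RA_conj ρ hN hy _) ?_
        obtain ⟨n, hn⟩ := hyn
        exact ⟨n, by rw [← cj_pow, hn]; simp [cj]⟩
      calc y (ρ h v) = (ρ h * ρ h⁻¹ * y * ρ h) v := by rw [rho_mul_inv, one_mul]; rfl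
        _ = ρ h (cj ρ y h⁻¹ v) := by unfold cj; rw [inv_inv]; rfl
        _ = 0 := by rw [h1, map_zero]
    · intro hbot
      let F : Set (AddSubgroup V) := {S | S ≠ ⊥ ∧ ∀ y ∈ RA ρ A, ∀ v ∈ S, y v ∈ S}
      obtain ⟨S, hS⟩ := (Set.toFinite F).exists_minimal ⟨⊤, top_ne_bot, fun _ _ _ _ => trivial⟩
      apply hS.prop.1
      rw [eq_bot_iff]
      intro v hv
      rw [← hbot, hmem]
      intro y hy hyn
      by_contra hyv
      have hSm : S.map y ∈ F := by
        refine ⟨?_, ?_⟩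
        · intro h
          have : y v ∈ S.map y := ⟨v, hv, rfl⟩
          rw [h] at this
          exact hyv this
        · rintro z hz _ ⟨s, hs, rfl⟩
          refine ⟨z s, hS.prop.2 z hz s hs, ?_⟩
          calc y (z s) = (y * z) s := rfl
            _ = _ := by rw [RA_comm ρ hA hy hz]; rfl
      have hle : S.map y ≤ S := by
        rintro _ ⟨s, hs, rfl⟩
        exact hS.prop.2 y hy s hs
      have hge := hS.le_of_le hSm hle
      have hpow : ∀ n, ∀ s ∈ S, ∃ t ∈ S, (y ^ n) t = s := by
        intro n
        induction n with
        | zero => intro s hs; exact ⟨s, hs, by rw [pow_zero]; rfl⟩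
        | succ n ih =>
          intro s hs
          obtain ⟨t, ht, rfl⟩ := ih s hs
          obtain ⟨r, hr, rfl⟩ := hge ht
          exact ⟨r, hr, by rw [pow_succ]; rfl⟩
      obtain ⟨n, hn⟩ := hyn
      apply hS.prop.1
      rw [eq_bot_iff]
      intro s hs
      obtain ⟨t, ht, rfl⟩ := hpow n s hs
      rw [hn]; rfl
  ext v
  have : v ∈ U := by rw [hU]; trivial
  exact (hmem v).1 this x hx hn

lemma range_card_lt [Finite V] {e f : AddMonoid.End V} (he : e * e = e) (hef : e * f = f * e)
    (hff : f * f = f) (hne : e * f ≠ e) : Nat.card (AddMonoidHom.range (e * f)) < Nat.card (AddMonoidHom.range e) := by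
  have hle : AddMonoidHom.range (e * f) ≤ AddMonoidHom.range e := by
    rintro _ ⟨v, rfl⟩; exact ⟨f v, rfl⟩
  have : (AddMonoidHom.range (e * f) : Set V) ⊂ AddMonoidHom.range e := by
    refine lt_of_le_of_ne hle ?_
    intro heq
    apply hne
    have h1 : e * f * e = e := by
      ext v
      have : e v ∈ (AddMonoidHom.range (e * f) : Set V) := by rw [heq]; exact ⟨v, rfl⟩
      obtain ⟨u, hu⟩ := this
      calc (e * f * e) v = (e * f) (e v) := rfl
        _ = (e * f) ((e * f) u) := congrArg _ hu.symm
        _ = (e * (f * e) * f) u := rfl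
        _ = ((e * e) * (f * f)) u := by rw [← hef]; rfl
        _ = e v := by rw [he, hff]; exact hu
    rw [mul_assoc, ← hef, ← mul_assoc, he] at h1
    exact h1
  exact Set.Finite.card_lt_card (Set.toFinite _) this

lemma field_or [Finite H] [Group.IsSolvable H] [Finite V] [Nontrivial V] (hρ : Irr ρ) {p w : ℕ}
    (hp : p.Prime)
    (hc : Nat.card V = p ^ w) (hL : ∀ m < p ^ w, Lin.{u} m) (hP : ∀ m < p ^ w, Per.{u} m)
    {A : Subgroup H} (hN : A.Normal) (hA : ∀ a ∈ A, ∀ b ∈ A, a * b = b * a) :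
    (∀ h ∈ derivedSeries H (fb p w), ρ h = 1) ∨ ∀ x ∈ RA ρ A, x ≠ 0 → ∃ y ∈ RA ρ A, x * y = 1 := by
  haveI : Finite (AddMonoid.End V) := DFunLike.finite _
  by_cases hid : ∀ e ∈ RA ρ A, e * e = e → e ≠ 0 → e = 1
  · right
    intro x hx hx0
    obtain ⟨n, hn, h⟩ := exists_pow_idem x
    have h1 : x ^ n = 1 := by
      refine hid _ (pow_mem hx n) h ?_
      intro h0
      exact hx0 (RA_nil hρ hN hA hx ⟨n, h0⟩)
    refine ⟨x ^ (n - 1), pow_mem hx _, ?_⟩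
    rw [← pow_succ', Nat.sub_add_cancel hn, h1]
  · left
    push Not at hid
    obtain ⟨e0, he0, hi0, hn0, hne⟩ := hid
    let F : Set (AddMonoid.End V) := {e | e ∈ RA ρ A ∧ e * e = e ∧ e ≠ 0 ∧ e ≠ 1}
    obtain ⟨e, he, hmin⟩ := Set.exists_min_image F (fun e => Nat.card (AddMonoidHom.range e))
      (Set.toFinite _) ⟨e0, he0, hi0, hn0, hne⟩
    obtain ⟨heR, hei, hen, he1⟩ := he
    -- `e f` is `0` or `e` for idempotents `f`
    have key : ∀ f ∈ RA ρ A, f * f = f → e * f = 0 ∨ e * f = e := by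
      intro f hf hff
      by_contra hcon
      push Not at hcon
      have hcm := RA_comm ρ hA heR hf
      have hlt := range_card_lt hei hcm hff hcon.2
      have := hmin (e * f) ⟨mul_mem heR hf, by
        calc e * f * (e * f) = e * (f * e) * f := by simp only [mul_assoc]
          _ = (e * e) * (f * f) := by rw [← hcm]; simp only [mul_assoc]
          _ = e * f := by rw [hei, hff], hcon.1, ?_⟩
      · omega
      · intro h
        apply he1
        calc e = e * 1 := (mul_one e).symm
          _ = e * (e * f) := by rw [h]
          _ = 1 := by rw [← mul_assoc, hei, h]
    refine imprim hρ hp hc hL hP hei hen he1 ?_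
    intro h
    have hfR := RA_conj ρ hN heR h
    rcases key _ hfR (cj_idem hei h) with h1 | h1
    · exact Or.inr h1
    · left
      have h2 : cj ρ (cj ρ e h⁻¹) h = e := by
        have : cj ρ (cj ρ e h⁻¹) h = cj ρ e (h * h⁻¹) := by rw [cj_mul]; rfl
        rw [this]; simp [cj]
      have h3 : cj ρ (e * cj ρ e h⁻¹) h = e := by
        rw [cj_mul', h2, ← RA_comm ρ hA heR hfR, h1]
      rcases key _ (RA_conj ρ hN heR h⁻¹) (cj_idem hei h⁻¹) with h4 | h4
      · rw [h4] at h3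
        exact absurd h3.symm (by simpa [cj] using hen)
      · rw [h4] at h3
        exact h3
end
end DL

set_option linter.style.haveILetI false

namespace DL
universe u
open scoped commutatorElement

lemma count1 {M K V : Type*} [Group M] [Finite M] [Field K] [AddCommGroup V] [Module K V]
    [FiniteDimensional K V] [Nontrivial V] (σ : M →* Module.End K V) (hσ : Function.Injective σ)
    (hs : ∀ x y : M, ∃ k : K, σ ⁅x, y⁆ = k • 1) :
    (Subgroup.center M).index ≤ Module.finrank K V ^ 2 := by
  classical
  have hinv : ∀ x : M, σ x⁻¹ * σ x = 1 := fun x => by rw [← map_mul]; simp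
  have hinv2 : ∀ x : M, σ x * σ x⁻¹ = 1 := fun x => by rw [← map_mul]; simp
  have huniq : ∀ (k l : K) (x : M), k • σ x = l • σ x → k = l := by
    intro k l x h
    have h2 : k • (1 : Module.End K V) = l • 1 := by
      have := congrArg (fun f => f * σ x⁻¹) h
      simpa only [smul_mul_assoc, hinv2] using this
    obtain ⟨v, hv⟩ := exists_ne (0 : V)
    have h3 := congrArg (fun f : Module.End K V => f v) h2
    exact smul_left_injective K hv h3
  choose χ0 hχ0 using hs
  have hcm : ∀ b m, σ b * σ m = χ0 b m • (σ m * σ b) := by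
    intro b m
    have : b * m = ⁅b, m⁆ * (m * b) := by rw [commutatorElement_def]; group
    rw [← map_mul, this, map_mul, hχ0, map_mul, smul_mul_assoc, one_mul]
  let χ : M → (M →* K) := fun m =>
    { toFun := fun b => χ0 b m
      map_one' := by
        apply huniq _ _ (1 : M)
        have := hχ0 1 m
        rw [commutatorElement_one_left] at this
        rw [one_smul, map_one, ← this, map_one]
      map_mul' := by
        intro b c
        apply huniq _ _ (m * (b * c))
        rw [map_mul σ m, ← hcm, map_mul, mul_assoc, hcm c m, mul_smul_comm, ← mul_assoc, hcm b m,
          smul_mul_assoc, smul_smul, mul_comm (χ0 c m), mul_assoc] }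
  have hχ : ∀ m b, χ m b = χ0 b m := fun _ _ => rfl
  have hχinj : ∀ m m', χ m = χ m' → m⁻¹ * m' ∈ Subgroup.center M := by
    intro m m' h
    rw [Subgroup.mem_center_iff]
    intro b
    have h1 : ⁅b, m⁆ = ⁅b, m'⁆ := by
      apply hσ
      rw [hχ0, hχ0, ← hχ, ← hχ, h]
    rw [commutatorElement_def, commutatorElement_def] at h1
    have h2 : m * b⁻¹ * m⁻¹ = m' * b⁻¹ * m'⁻¹ := by
      have := congrArg (fun x => b⁻¹ * x) h1
      simpa only [mul_assoc, inv_mul_cancel_left] using this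
    have h3 : m * b * m⁻¹ = m' * b * m'⁻¹ := by
      have := congrArg (fun x => x⁻¹) h2
      simpa only [mul_inv_rev, inv_inv, mul_assoc] using this
    calc b * (m⁻¹ * m') = m⁻¹ * (m * b * m⁻¹) * m' := by group
      _ = m⁻¹ * m' * b := by rw [h3]; group
  haveI : Fintype (M ⧸ Subgroup.center M) := Fintype.ofFinite _
  have hind : LinearIndependent K (fun q : M ⧸ Subgroup.center M => (χ q.out : M → K)) := by
    have := (linearIndependent_monoidHom M K).comp (fun q : M ⧸ Subgroup.center M => χ q.out) (by
      intro q q' h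
      have := hχinj _ _ h
      rw [← QuotientGroup.eq] at this
      simpa using this)
    exact this
  have hli : LinearIndependent K (fun q : M ⧸ Subgroup.center M => σ q.out) := by
    rw [Fintype.linearIndependent_iff]
    intro c hc q
    obtain ⟨v, hv⟩ := exists_ne (0 : V)
    have hall : ∀ φ : Module.Dual K V, c q * φ (σ q.out v) = 0 := by
      intro φ
      rw [Fintype.linearIndependent_iff] at hind
      refine hind (fun q => c q * φ (σ q.out v)) ?_ q
      funext b
      have h1 : σ b * (∑ q, c q • σ q.out) * σ b⁻¹ = 0 := by rw [hc]; simp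
      rw [Finset.mul_sum, Finset.sum_mul] at h1
      have h2 : ∑ q : M ⧸ Subgroup.center M, (c q * χ q.out b) • σ q.out = 0 := by
        rw [← h1]
        refine Finset.sum_congr rfl fun q _ => ?_
        rw [mul_smul_comm, smul_mul_assoc, hcm, smul_mul_assoc, mul_assoc, hinv2, mul_one, smul_smul]
        rfl
      have h3 := congrArg (fun f : Module.End K V => φ (f v)) h2
      simp only [LinearMap.sum_apply, map_sum, LinearMap.smul_apply, map_smul, smul_eq_mul,
        LinearMap.zero_apply, map_zero] at h3
      simp only [Finset.sum_apply, Pi.smul_apply, smul_eq_mul, Pi.zero_apply]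
      rw [← h3]
      refine Finset.sum_congr rfl fun q _ => ?_
      ring
    by_contra hcq
    have h0 : σ q.out v = 0 := by
      rw [← Module.forall_dual_apply_eq_zero_iff K]
      intro φ
      exact (mul_eq_zero.1 (hall φ)).resolve_left hcq
    apply hv
    calc v = (σ q.out⁻¹ * σ q.out) v := by rw [hinv]; rfl
      _ = 0 := by rw [Module.End.mul_apply, h0, map_zero]
  have := hli.fintype_card_le_finrank
  rw [Module.finrank_linearMap, ← sq] at this
  rw [Subgroup.index, Nat.card_eq_fintype_card]
  exact this

lemma card_hom_le {G K : Type*} [Group G] [Finite G] [Field K] [Finite K] :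
    Nat.card (G →* K) ≤ Nat.card G := by
  haveI : Fintype G := Fintype.ofFinite _
  haveI : Finite (G →* K) := DFunLike.finite _
  haveI : Fintype (G →* K) := Fintype.ofFinite _
  have := (linearIndependent_monoidHom G K).fintype_card_le_finrank
  rw [Module.finrank_fintype_fun_eq_card] at this
  rw [Nat.card_eq_fintype_card, Nat.card_eq_fintype_card]
  exact this

lemma count2 {H K : Type*} [Group H] [Finite H] [Field K] [Finite K] {A B X : Subgroup H}
    (hAB : A ≤ B) (hBX : B ≤ X) (μ : A →* K) (hμ : Function.Injective μ)
    (hAX : ∀ x ∈ X, ∀ a ∈ A, a * x = x * a) (hXB : ∀ b ∈ B, ∀ x ∈ X, ⁅b, x⁆ ∈ A)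
    (hc : ∀ x ∈ X, (∀ b ∈ B, b * x = x * b) → x ∈ A) : X ≤ B := by
  haveI hn : (A.subgroupOf B).Normal := by
    constructor
    intro a ha b
    rw [Subgroup.mem_subgroupOf] at *
    have := hAX b (hBX b.2) a ha
    have h2 : ((b * a * b⁻¹ : B) : H) = a := by push_cast; rw [← this]; group
    rw [h2]; exact ha
  let χ1 : X → (B →* K) := fun x =>
    { toFun := fun b => μ ⟨⁅(b : H), (x : H)⁆, hXB b b.2 x x.2⟩
      map_one' := by
        rw [← map_one μ]; congr 1; ext; simp
      map_mul' := by
        intro b c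
        rw [← map_mul]
        congr 1
        ext
        have h1 := hAX b (hBX b.2) _ (hXB c c.2 x x.2)
        simp only [Subgroup.coe_mul]
        calc ⁅(b : H) * c, (x : H)⁆ = (b : H) * ⁅(c : H), (x : H)⁆ * (b : H)⁻¹ * ⁅(b : H), (x : H)⁆ := by
              simp only [commutatorElement_def]; group
          _ = ⁅(c : H), (x : H)⁆ * ⁅(b : H), (x : H)⁆ := by rw [← h1]; group
          _ = _ := hAX _ (hBX (hAB (hXB b b.2 x x.2))) _ (hXB c c.2 x x.2) }
  have hker : ∀ x : X, ∀ b ∈ A.subgroupOf B, χ1 x b = 1 := by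
    intro x b hb
    rw [Subgroup.mem_subgroupOf] at hb
    change μ _ = 1
    rw [← map_one μ]
    congr 1
    ext
    change ⁅(b : H), (x : H)⁆ = 1
    rw [commutatorElement_eq_one_iff_mul_comm]
    exact hAX x x.2 b hb
  have hinj : ∀ x y : X, χ1 x = χ1 y → (x : H)⁻¹ * y ∈ A := by
    intro x y h
    apply hc _ (X.mul_mem (X.inv_mem x.2) y.2)
    intro b hb
    have h0 := DFunLike.congr_fun h ⟨b, hb⟩
    have h1 : ⁅b, (x : H)⁆ = ⁅b, (y : H)⁆ := congrArg Subtype.val (hμ h0)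
    rw [commutatorElement_def, commutatorElement_def] at h1
    have h2 : (x : H) * b⁻¹ * (x : H)⁻¹ = y * b⁻¹ * (y : H)⁻¹ := by
      have := congrArg (fun x => b⁻¹ * x) h1
      simpa only [mul_assoc, inv_mul_cancel_left] using this
    have h3 : (x : H) * b * (x : H)⁻¹ = y * b * (y : H)⁻¹ := by
      have := congrArg (fun x => x⁻¹) h2
      simpa only [mul_inv_rev, inv_inv, mul_assoc] using this
    calc b * ((x : H)⁻¹ * y) = (x : H)⁻¹ * (x * b * (x : H)⁻¹) * y := by group
      _ = (x : H)⁻¹ * y * b := by rw [h3]; group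
  let e : X ⧸ A.subgroupOf X → (B ⧸ A.subgroupOf B →* K) := fun q =>
    (QuotientGroup.con (A.subgroupOf B)).lift (χ1 q.out) (by
      intro b c hbc
      rw [Con.ker_rel]
      have h1 : b⁻¹ * c ∈ A.subgroupOf B := QuotientGroup.leftRel_apply.1 hbc
      have h2 : c = b * (b⁻¹ * c) := by group
      rw [h2, map_mul, hker _ _ h1, mul_one])
  have he : Function.Injective e := by
    intro q q' h
    have : χ1 q.out = χ1 q'.out := by
      ext b
      exact DFunLike.congr_fun h (QuotientGroup.mk b)
    have h2 : q.out⁻¹ * q'.out ∈ A.subgroupOf X := by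
      rw [Subgroup.mem_subgroupOf]; exact hinj _ _ this
    rw [← QuotientGroup.eq] at h2
    simpa using h2
  haveI : Finite (B ⧸ A.subgroupOf B →* K) := DFunLike.finite _
  have h1 : A.relIndex X ≤ A.relIndex B := by
    refine (Nat.card_le_card_of_injective e he).trans card_hom_le
  have h2 := Subgroup.relIndex_mul_relIndex A B X hAB hBX
  have h3 : 0 < A.relIndex B := Nat.pos_of_ne_zero Subgroup.index_ne_zero_of_finite
  have h4 : 0 < B.relIndex X := Nat.pos_of_ne_zero Subgroup.index_ne_zero_of_finite
  have h5 : B.relIndex X = 1 := by nlinarith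
  exact Subgroup.relIndex_eq_one.1 h5

end DL

set_option linter.style.haveILetI false

namespace DL
universe u
open scoped commutatorElement

lemma comm_le_centralizer {H : Type*} [Group H] [Finite H] (A : Subgroup H) [A.Normal] [IsCyclic A] :
    ⁅(⊤ : Subgroup H), ⊤⁆ ≤ Subgroup.centralizer (A : Set H) := by
  rw [Subgroup.commutator_le]
  intro g _ h _
  have hpow : ∀ g : H, ∃ m : ℤ, ∀ a ∈ A, g * a * g⁻¹ = a ^ m := by
    intro g
    obtain ⟨m, hm⟩ := MonoidHom.map_cyclic ((MulAut.conjNormal g : MulAut A) : A →* A)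
    refine ⟨m, fun a ha => ?_⟩
    have := congrArg Subtype.val (hm ⟨a, ha⟩)
    simpa using this
  rw [Subgroup.mem_centralizer_iff]
  intro a ha
  obtain ⟨m, hm⟩ := hpow g
  obtain ⟨n, hn⟩ := hpow h
  have hz : ∀ (x y : H) (k : ℤ), (x * y * x⁻¹) ^ k = x * y ^ k * x⁻¹ := fun x y k => conj_zpow
  have h1 : g * (h * a * h⁻¹) * g⁻¹ = h * (g * a * g⁻¹) * h⁻¹ := by
    rw [hn a ha, hm a ha, ← hz, ← hz, hm a ha, hn a ha, zpow_comm]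
  have h2 : g * h * a * (g * h)⁻¹ = h * g * a * (h * g)⁻¹ := by
    calc g * h * a * (g * h)⁻¹ = g * (h * a * h⁻¹) * g⁻¹ := by group
      _ = h * (g * a * g⁻¹) * h⁻¹ := h1
      _ = _ := by group
  -- apply to `a' = (h g)⁻¹ a (h g)`
  have h3 : ∀ a ∈ A, g * h * a * (g * h)⁻¹ = h * g * a * (h * g)⁻¹ := by
    intro a ha
    have h1 : g * (h * a * h⁻¹) * g⁻¹ = h * (g * a * g⁻¹) * h⁻¹ := by
      rw [hn a ha, hm a ha, ← hz, ← hz, hm a ha, hn a ha, zpow_comm]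
    calc g * h * a * (g * h)⁻¹ = g * (h * a * h⁻¹) * g⁻¹ := by group
      _ = h * (g * a * g⁻¹) * h⁻¹ := h1
      _ = _ := by group
  have hA : A.Normal := inferInstance
  have h4 := h3 ((h * g)⁻¹ * a * (h * g)) (by simpa using hA.conj_mem a ha (h * g)⁻¹)
  have h5 : ⁅g, h⁆ * a * ⁅g, h⁆⁻¹ = a := by
    calc ⁅g, h⁆ * a * ⁅g, h⁆⁻¹ = g * h * ((h * g)⁻¹ * a * (h * g)) * (g * h)⁻¹ := by
          rw [commutatorElement_def]; group
      _ = h * g * ((h * g)⁻¹ * a * (h * g)) * (h * g)⁻¹ := h4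
      _ = a := by group
  calc a * ⁅g, h⁆ = ⁅g, h⁆ * a * ⁅g, h⁆⁻¹ * ⁅g, h⁆ := by rw [h5]
    _ = _ := by group

lemma sq_lt_three_pow (D : ℕ) : D ^ 2 < 3 ^ D := by
  rcases Nat.lt_or_ge D 2 with h | h
  · interval_cases D <;> norm_num
  · induction D, h using Nat.le_induction with
    | base => norm_num
    | succ n hn ih => rw [pow_succ 3]; nlinarith

lemma core {H V : Type u} {K : Type*} [Group H] [Finite H] [Group.IsSolvable H] [AddCommGroup V]
    [Finite V] [Nontrivial V] [Field K] [Finite K] [Module K V] (ρ : H →* AddMonoid.End V)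
    (hinj : Function.Injective ρ) {p w : ℕ} (hp : p.Prime) (hc : Nat.card V = p ^ w) (hw : 2 ≤ w)
    (hL : ∀ m < p ^ w, Lin.{u} m) (A : Subgroup H) (hN : A.Normal)
    (hA : ∀ a ∈ A, ∀ b ∈ A, a * b = b * a)
    (hmax : ∀ B : Subgroup H, B.Normal → (∀ a ∈ B, ∀ b ∈ B, a * b = b * a) → A ≤ B → B ≤ A)
    (hA0 : A ≠ ⊥) (hAs : ∀ a ∈ A, ∃ k : K, ∀ v, ρ a v = k • v)
    (hCs : ∀ c, (∀ a ∈ A, a * c = c * a) → ∀ (k : K) v, ρ c (k • v) = k • ρ c v) :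
    derivedSeries H (fb p w) = ⊥ := by
  obtain ⟨v0, hv0⟩ := exists_ne (0 : V)
  have huniq : ∀ k l : K, (∀ v : V, k • v = l • v) → k = l :=
    fun k l h => smul_left_injective K hv0 (h v0)
  choose! μ0 hμ0 using hAs
  let μ : A →* K :=
    { toFun := fun a => μ0 a
      map_one' := by
        apply huniq
        intro v
        rw [one_smul, Subgroup.coe_one, ← hμ0 1 A.one_mem, map_one]; rfl
      map_mul' := by
        intro a b
        apply huniq
        intro v
        rw [mul_smul, Subgroup.coe_mul, ← hμ0 _ (A.mul_mem a.2 b.2), ← hμ0 b b.2, ← hμ0 a a.2, map_mul]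
        rfl }
  have hμ : Function.Injective μ := by
    intro a b h
    ext
    apply hinj
    ext v
    rw [hμ0 a a.2, hμ0 b b.2]
    exact congrArg (· • v) h
  haveI hcyc : IsCyclic A := isCyclic_of_injective_ringHom μ hμ
  set C := Subgroup.centralizer (A : Set H) with hC
  have memC : ∀ c, c ∈ C ↔ ∀ a ∈ A, a * c = c * a := fun c => Subgroup.mem_centralizer_iff
  have hH1 : derivedSeries H 1 ≤ C := by
    rw [derivedSeries_one, commutator_def]; exact comm_le_centralizer A
  have hAC : A ≤ C := fun a ha => (memC a).2 fun b hb => hA b hb a ha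
  have hCn : C.Normal := inferInstance
  have hAA : ⁅A, A⁆ = ⊥ := Subgroup.commutator_eq_bot_iff_le_centralizer.2 hAC
  -- dimensions
  haveI : Module.Finite K V := Module.Finite.of_finite
  set D := Module.finrank K V with hD
  have hD0 : 0 < D := Module.finrank_pos
  have hcV : Nat.card V = Nat.card K ^ D := Module.natCard_eq_pow_finrank
  have hK3 : 3 ≤ Nat.card K := by
    obtain ⟨a, ha1⟩ := Subgroup.ne_bot_iff_exists_ne_one.1 hA0
    have h1 : μ a ≠ 1 := fun h => ha1 (hμ (h.trans (map_one μ).symm))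
    have h0 : μ a ≠ 0 := by
      intro h
      have : μ (a * a⁻¹) = 0 := by rw [map_mul, h, zero_mul]
      rw [mul_inv_cancel, map_one] at this
      exact one_ne_zero this
    classical
    haveI := Fintype.ofFinite K
    rw [Nat.card_eq_fintype_card]
    have : ({0, 1, μ a} : Finset K).card = 3 := by
      rw [Finset.card_eq_three]
      exact ⟨0, 1, μ a, zero_ne_one, h0.symm, h1.symm, rfl⟩
    rw [← this]
    exact Finset.card_le_univ _
  obtain ⟨s, -, hs⟩ := (Nat.dvd_prime_pow hp).1
    (show Nat.card K ∣ p ^ w by rw [← hc, hcV]; exact dvd_pow_self _ hD0.ne')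
  have hwsD : w = s * D := by
    rw [hc, hs, ← pow_mul] at hcV
    exact Nat.pow_right_injective hp.two_le hcV
  have hs0 : 0 < s := by
    rcases Nat.eq_zero_or_pos s with h | h
    · rw [h] at hs; simp at hs; omega
    · exact h
  have hDw : D ≤ w := by rw [hwsD]; exact Nat.le_mul_of_pos_left D hs0
  have h2D : p = 2 → 2 * D ≤ w := by
    intro h2
    rw [hwsD]
    apply Nat.mul_le_mul_right
    by_contra hcon
    have : s = 1 := by omega
    rw [this, h2] at hs; omega
  have hD2 : D ^ 2 < p ^ w := by
    rw [← hc, hcV]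
    exact (sq_lt_three_pow D).trans_le (Nat.pow_le_pow_left hK3 D)
  -- the counting bound
  have hcount : ∀ M : Subgroup H, M.Normal → A ≤ M → M ≤ C → ⁅M, M⁆ ≤ A → A.relIndex M ≤ D ^ 2 := by
    intro M hMn hAM hMC hMM
    let σ : M →* Module.End K V :=
      { toFun := fun m =>
          { toFun := fun v => ρ (m : H) v
            map_add' := fun x y => map_add _ x y
            map_smul' := fun k v => hCs m ((memC _).1 (hMC m.2)) k v }
        map_one' := by ext v; change ρ 1 v = v; rw [map_one]; rfl
        map_mul' := by
          intro x y
          ext v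
          change ρ ((x : H) * y) v = ρ (x : H) (ρ (y : H) v)
          rw [map_mul]; rfl }
    have hσ : ∀ (m : M) v, σ m v = ρ (m : H) v := fun _ _ => rfl
    have h1 := count1 σ (by
      intro x y h
      ext
      apply hinj
      ext v
      rw [← hσ, ← hσ, h]) (by
      intro x y
      have h2 : ((⁅x, y⁆ : M) : H) ∈ A := hMM (Subgroup.commutator_mem_commutator x.2 y.2)
      refine ⟨μ0 ((⁅x, y⁆ : M) : H), ?_⟩
      ext v
      rw [hσ, hμ0 _ h2]; rfl)
    refine le_trans (le_of_eq ?_) h1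
    have : Subgroup.center M = A.subgroupOf M := by
      have hZ : M ⊓ Subgroup.centralizer (M : Set H) ≤ A := by
        refine hmax _ inferInstance ?_ ?_
        · intro a ha b hb
          exact (Subgroup.mem_centralizer_iff.1 hb.2 a ha.1)
        · refine le_inf hAM ?_
          intro a ha
          rw [Subgroup.mem_centralizer_iff]
          intro m hm
          exact ((memC m).1 (hMC hm) a ha).symm
      ext m
      rw [Subgroup.mem_subgroupOf, Subgroup.mem_center_iff]
      constructor
      · intro h
        refine hZ ⟨m.2, Subgroup.mem_centralizer_iff.2 ?_⟩
        intro g hg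
        exact congrArg Subtype.val (h ⟨g, hg⟩)
      · intro h g
        ext
        exact ((memC _).1 (hMC g.2) _ h).symm
    rw [this]; rfl
  rcases Nat.lt_or_ge D 2 with hD1 | hDge
  · -- one dimensional
    have hCA : C ≤ A := by
      by_contra hcon
      have hlt : A < C := lt_of_le_not_ge hAC hcon
      obtain ⟨M, hM, hMC⟩ := exists_chief_above hN hCn hlt
      have h1 := hcount M hM.nM hM.lt.le hMC (chief_main hM).1
      have h2 : A.relIndex M ≠ 0 := Subgroup.index_ne_zero_of_finite
      have h3 : D = 1 := by omega
      rw [h3] at h1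
      have h4 : A.relIndex M = 1 := by omega
      exact absurd (Subgroup.relIndex_eq_one.1 h4) (not_le_of_gt hM.lt)
    rw [eq_bot_iff]
    refine (derivedSeries_antitone H (fb_ge_two hw)).trans ?_
    rw [← hAA, derivedSeries_succ]
    exact Subgroup.commutator_mono (hH1.trans hCA) (hH1.trans hCA)
  · have hf3 : 3 ≤ fb p w := fb_ge_three hDge hDw h2D
    obtain ⟨T, hT⟩ : ∃ T, fb p w = T + 2 := ⟨fb p w - 2, by omega⟩
    have hchief : ∀ M, Chief A M → M ≤ C → ⁅M, M⁆ ≤ A ∧ ⁅derivedSeries H T, M⁆ ≤ A := by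
      intro M hM hMC
      obtain ⟨hMM, q, a, hq, ha, hqa, hlin⟩ := chief_main hM
      refine ⟨hMM, ?_⟩
      have h1 := hcount M hM.nM hM.lt.le hMC hMM
      rw [hqa] at h1
      have h2 := fb_prim hDge hDw h2D hq.two_le ha h1
      refine le_trans (Subgroup.commutator_mono (derivedSeries_antitone H ?_) le_rfl)
        (hlin (hL _ (lt_of_le_of_lt h1 hD2)))
      omega
    let F : Set (Subgroup H) :=
      {B | B.Normal ∧ A ≤ B ∧ B ≤ C ∧ ⁅B, B⁆ ≤ A ∧ ⁅derivedSeries H T, B⁆ ≤ A}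
    obtain ⟨B, hB⟩ := (Set.toFinite F).exists_maximal ⟨A, hN, le_rfl, hAC, by rw [hAA]; exact bot_le,
      Subgroup.commutator_le_right _ _⟩
    obtain ⟨hBn, hAB, hBC, hBB, hTB⟩ := hB.prop
    have hY : C ⊓ Subgroup.centralizer (B : Set H) ≤ A := by
      by_contra hcon
      have hAY : A ≤ C ⊓ Subgroup.centralizer (B : Set H) := by
        refine le_inf hAC ?_
        intro a ha
        rw [Subgroup.mem_centralizer_iff]
        intro b hb
        exact ((memC b).1 (hBC hb) a ha).symm
      obtain ⟨M, hM, hMY⟩ := exists_chief_above hN (inferInstance) (lt_of_le_not_ge hAY hcon)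
      obtain ⟨hMM, hTM⟩ := hchief M hM (hMY.trans inf_le_left)
      have hMB : ⁅M, B⁆ = ⊥ :=
        Subgroup.commutator_eq_bot_iff_le_centralizer.2 (hMY.trans inf_le_right)
      have hMn := hM.nM
      have hmem : B ⊔ M ∈ F := by
        refine ⟨inferInstance, hAB.trans le_sup_left, sup_le hBC (hMY.trans inf_le_left), ?_, ?_⟩
        · refine sup_comm_le ?_ ?_
          · rw [Subgroup.commutator_comm]
            exact sup_comm_le hBB (by rw [hMB]; exact bot_le)
          · rw [Subgroup.commutator_comm]
            refine sup_comm_le ?_ hMM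
            rw [Subgroup.commutator_comm, hMB]; exact bot_le
        · rw [Subgroup.commutator_comm]
          refine sup_comm_le ?_ ?_
          · rw [Subgroup.commutator_comm]; exact hTB
          · rw [Subgroup.commutator_comm]; exact hTM
      have hMleB : M ≤ B := le_sup_right.trans (hB.le_of_ge hmem le_sup_left)
      have := hmax M hMn (by
        intro a ha b hb
        exact Subgroup.mem_centralizer_iff.1 (hMY hb).2 a (hMleB ha)) hM.lt.le
      exact absurd this (not_le_of_gt hM.lt)
    have hX : C ⊓ cmod A B ≤ B := by
      refine count2 hAB (le_inf hBC (le_cmod.2 hBB)) μ hμ ?_ ?_ ?_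
      · intro x hx a ha
        exact (memC x).1 hx.1 a ha
      · intro b hb x hx
        have h1 : ⁅cmod A B, B⁆ ≤ A := le_cmod.1 le_rfl
        rw [Subgroup.commutator_comm] at h1
        exact h1 (Subgroup.commutator_mem_commutator hb hx.2)
      · intro x hx h
        exact hY ⟨hx.1, Subgroup.mem_centralizer_iff.2 h⟩
    have hT1 : derivedSeries H T ≤ B := by
      refine le_trans (le_inf ?_ (le_cmod.2 hTB)) hX
      exact (derivedSeries_antitone H (by omega)).trans hH1
    have hT2 : derivedSeries H (T + 1) ≤ A := by
      rw [derivedSeries_succ]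
      exact (Subgroup.commutator_mono hT1 hT1).trans hBB
    rw [hT, eq_bot_iff, ← hAA, derivedSeries_succ]
    exact Subgroup.commutator_mono hT2 hT2

end DL

set_option linter.style.haveILetI false

namespace DL
universe u
open scoped commutatorElement

lemma lin_one {H V : Type u} [Group H] [AddCommGroup V] (ρ : H →* AddMonoid.End V) {p : ℕ}
    (hp : p.Prime) (hc : Nat.card V = p) : ∀ h ∈ derivedSeries H (fb p 1), ρ h = 1 := by
  haveI : Fact p.Prime := ⟨hp⟩
  haveI := isAddCyclic_of_prime_card hc
  have hm : ∀ h, ∃ m : ℤ, ∀ v, ρ h v = m • v := fun h => AddMonoidHom.map_addCyclic (ρ h)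
  by_cases h2 : p = 2
  · intro h _
    ext v
    obtain ⟨m, hm⟩ := hm h
    have h2v : (2 : ℤ) • v = 0 := by
      have h3 : Nat.card V • v = 0 := card_nsmul_eq_zero'
      rw [hc, h2] at h3
      exact_mod_cast h3
    change ρ h v = v
    rcases Int.even_or_odd' m with ⟨k, hk | hk⟩
    · have h0 : ρ h v = 0 := by rw [hm, hk, mul_comm, mul_smul, h2v, smul_zero]
      have h1 : v = 0 := by
        calc v = (ρ h⁻¹ * ρ h) v := by rw [rho_inv_mul]; rfl
          _ = ρ h⁻¹ (ρ h v) := rfl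
          _ = 0 := by rw [h0, map_zero]
      rw [h1, map_zero]
    · rw [hm, hk, add_smul, mul_comm, mul_smul, h2v, smul_zero, zero_add, one_smul]
  · have hf : fb p 1 = 1 := by unfold fb; simp [h2]
    rw [hf, derivedSeries_one, commutator_def]
    have : ⁅(⊤ : Subgroup H), ⊤⁆ ≤ (MonoidHom.toHomUnits ρ).ker := by
      rw [Subgroup.commutator_le]
      intro g _ h _
      rw [MonoidHom.mem_ker, map_commutatorElement, commutatorElement_eq_one_iff_mul_comm]
      ext v
      obtain ⟨m, hm1⟩ := hm g
      obtain ⟨n, hn1⟩ := hm h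
      change ρ g (ρ h v) = ρ h (ρ g v)
      rw [hm1, hn1, hn1, hm1, smul_comm]
    intro h hh
    have h3 := this hh
    rw [MonoidHom.mem_ker] at h3
    exact congrArg Units.val h3

lemma lin_faithful {H V : Type u} [Group H] [Finite H] [Group.IsSolvable H] [AddCommGroup V]
    [Finite V] {ρ : H →* AddMonoid.End V} (hρ : Irr ρ)
    (hinj : Function.Injective ρ) {p w : ℕ} (hp : p.Prime) (hc : Nat.card V = p ^ w) (hw : 2 ≤ w)
    (hL : ∀ m < p ^ w, Lin.{u} m) (hP : ∀ m < p ^ w, Per.{u} m) :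
    ∀ h ∈ derivedSeries H (fb p w), ρ h = 1 := by
  haveI : Nontrivial V := by
    rw [← Finite.one_lt_card_iff_nontrivial, hc]
    exact Nat.one_lt_pow (by omega) hp.one_lt
  rcases subsingleton_or_nontrivial H with hsub | hnt
  · intro h _
    rw [Subsingleton.elim h 1, map_one]
  let F : Set (Subgroup H) := {B | B.Normal ∧ ∀ a ∈ B, ∀ b ∈ B, a * b = b * a}
  obtain ⟨A, hA⟩ := (Set.toFinite F).exists_maximal ⟨⊥, inferInstance, by
    intro a ha b hb
    rw [Subgroup.mem_bot] at ha hb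
    rw [ha, hb]⟩
  obtain ⟨hN, hab⟩ := hA.prop
  have hmax : ∀ B : Subgroup H, B.Normal → (∀ a ∈ B, ∀ b ∈ B, a * b = b * a) → A ≤ B → B ≤ A :=
    fun B h1 h2 h3 => hA.le_of_ge ⟨h1, h2⟩ h3
  have hA0 : A ≠ ⊥ := by
    intro h0
    obtain ⟨M, hM, -⟩ := exists_chief_above (G := H) (N := ⊥) (P := ⊤) inferInstance inferInstance
      bot_lt_top
    have h1 := (chief_main hM).1
    rw [le_bot_iff, Subgroup.commutator_eq_bot_iff_le_centralizer] at h1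
    have h2 := hmax M hM.nM (fun a ha b hb => Subgroup.mem_centralizer_iff.1 (h1 hb) a ha)
      (by rw [h0]; exact bot_le)
    rw [h0] at h2
    exact absurd h2 (not_le_of_gt hM.lt)
  rcases field_or hρ hp hc hL hP hN hab with h | hf
  · exact h
  haveI : Finite (AddMonoid.End V) := DFunLike.finite _
  have hfield : IsField (RA ρ A) :=
    { exists_pair_ne := ⟨0, 1, by
        intro h
        obtain ⟨v, hv⟩ := exists_ne (0 : V)
        have h1 : (0 : AddMonoid.End V) = 1 := congrArg Subtype.val h
        exact hv (congrArg (fun f : AddMonoid.End V => f v) h1).symm⟩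
      mul_comm := fun x y => Subtype.ext (RA_comm ρ hab x.2 y.2)
      mul_inv_cancel := by
        intro x hx
        obtain ⟨y, hy, hxy⟩ := hf x x.2 (fun h => hx (Subtype.ext h))
        exact ⟨⟨y, hy⟩, Subtype.ext hxy⟩ }
  letI : Field (RA ρ A) := hfield.toField
  have hbot := core (K := RA ρ A) ρ hinj hp hc hw hL A hN hab hmax hA0
    (fun a ha => ⟨⟨ρ a, RA_mem ρ ha⟩, fun v => rfl⟩)
    (by
      intro c hcc k v
      have := RA_centr ρ hcc k.2
      exact congrArg (fun f : AddMonoid.End V => f v) this.symm)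
  intro h hh
  rw [hbot, Subgroup.mem_bot] at hh
  rw [hh, map_one]

lemma lin_step (n : ℕ) (hL : ∀ m < n, Lin.{u} m) (hP : ∀ m < n, Per.{u} m) : Lin.{u} n := by
  intro H V _ _ _ _ _ ρ hρ p w hp hw hc hn
  subst hn
  rcases Nat.lt_or_ge w 2 with h1 | h2
  · have : w = 1 := by omega
    subst this
    rw [pow_one] at hc
    exact lin_one ρ hp hc
  · let f := ρ.toHomUnits.rangeRestrict
    have hf : Function.Surjective f := MonoidHom.rangeRestrict_surjective _
    haveI : Finite (ρ.toHomUnits.range) := Finite.of_surjective f hf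
    haveI : Group.IsSolvable (ρ.toHomUnits.range) := Group.isSolvable_of_surjective hf
    let ρ' : ρ.toHomUnits.range →* AddMonoid.End V := (Units.coeHom _).comp (Subgroup.subtype _)
    have hρf : ∀ h, ρ' (f h) = ρ h := fun _ => rfl
    have key := lin_faithful (ρ := ρ') (by
      intro U hU
      exact hρ U (fun h v hv => hU (f h) v hv)) (by
      intro x y h
      exact Subtype.ext (Units.ext h)) hp hc h2 hL hP
    intro h hh
    rw [← hρf]
    apply key
    rw [← map_derivedSeries_eq hf]
    exact ⟨h, hh, rfl⟩

theorem all_lin_per : ∀ n, Lin.{u} n ∧ Per.{u} n := by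
  intro n
  induction n using Nat.strong_induction_on with
  | _ n ih =>
    have hL : Lin.{u} n := lin_step n (fun m hm => (ih m hm).1) (fun m hm => (ih m hm).2)
    refine ⟨hL, per_step n ?_ (fun m hm => (ih m hm).2)⟩
    intro m hm
    rcases hm.lt_or_eq with h | h
    · exact (ih m h).1
    · rw [h]; exact hL

end DL

set_option linter.style.haveILetI false

namespace DL
universe u
open scoped commutatorElement

/-- three subgroups lemma modulo a normal subgroup -/
lemma three {G : Type*} [Group G] {A B C N : Subgroup G} [N.Normal] (h1 : ⁅⁅B, C⁆, A⁆ ≤ N)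
    (h2 : ⁅⁅C, A⁆, B⁆ ≤ N) : ⁅⁅A, B⁆, C⁆ ≤ N := by
  have key : ∀ A B C : Subgroup G, ⁅⁅A, B⁆, C⁆ ≤ N ↔
      ⁅⁅A.map (QuotientGroup.mk' N), B.map (QuotientGroup.mk' N)⁆, C.map (QuotientGroup.mk' N)⁆ = ⊥ := by
    intro A B C
    rw [← Subgroup.map_commutator, ← Subgroup.map_commutator, Subgroup.map_eq_bot_iff,
      QuotientGroup.ker_mk']
  rw [key] at *
  exact Subgroup.commutator_commutator_eq_bot_of_rotate h1 h2

/-- lower central series of a subgroup -/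
def lcs {G : Type*} [Group G] (L : Subgroup G) : ℕ → Subgroup G
  | 0 => L
  | n + 1 => ⁅lcs L n, L⁆

lemma lcs_normal {G : Type*} [Group G] (L : Subgroup G) [L.Normal] (n : ℕ) : (lcs L n).Normal := by
  induction n with
  | zero => assumption
  | succ n ih => exact Subgroup.commutator_normal _ _

lemma lcs_comm {G : Type*} [Group G] (L : Subgroup G) [L.Normal] (j : ℕ) :
    ∀ i, ⁅lcs L i, lcs L j⁆ ≤ lcs L (i + j + 1) := by
  induction j with
  | zero => intro i; exact le_rfl
  | succ j ih =>
    intro i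
    haveI := lcs_normal L (i + (j + 1) + 1)
    rw [Subgroup.commutator_comm]
    change ⁅⁅lcs L j, L⁆, lcs L i⁆ ≤ _
    refine three ?_ ?_
    · rw [Subgroup.commutator_comm L]
      refine (ih (i + 1)).trans (le_of_eq ?_)
      congr 1; omega
    · exact Subgroup.commutator_mono (ih i) le_rfl

lemma derived_le_lcs {G : Type*} [Group G] (t i : ℕ) :
    derivedSeries G (t + i) ≤ lcs (derivedSeries G t) (2 ^ i - 1) := by
  haveI := derivedSeries_normal G t
  induction i with
  | zero => exact le_rfl
  | succ i ih =>
    rw [← add_assoc, derivedSeries_succ]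
    refine (Subgroup.commutator_mono ih ih).trans ((lcs_comm _ _ _).trans (le_of_eq ?_))
    congr 1
    have : 0 < 2 ^ i := by positivity
    rw [pow_succ]; omega

lemma lcs_anti {G : Type*} [Group G] (L : Subgroup G) [L.Normal] {i j : ℕ} (h : i ≤ j) :
    lcs L j ≤ lcs L i := by
  induction j, h using Nat.le_induction with
  | base => exact le_rfl
  | succ j _ ih =>
    haveI := lcs_normal L j
    exact (Subgroup.commutator_le_left _ _).trans ih

lemma lcs_lt {G : Type*} [Group G] [Finite G] (L : Subgroup G) [L.Normal]
    (hL : ∀ N M : Subgroup G, Chief N M → ⁅L, M⁆ ≤ N) {n : ℕ} (h : lcs L n ≠ ⊥) :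
    lcs L (n + 1) < lcs L n := by
  obtain ⟨N, hN⟩ := exists_chief_below (lcs_normal L n) h
  refine lt_of_le_of_lt ?_ hN.lt
  change ⁅lcs L n, L⁆ ≤ N
  rw [Subgroup.commutator_comm]
  exact hL _ _ hN

lemma exists_t0 (G : Type u) [Group G] [Finite G] [Group.IsSolvable G] [Nontrivial G] :
    ∃ (N M : Subgroup G) (q a : ℕ), Chief N M ∧ q.Prime ∧ 0 < a ∧ N.relIndex M = q ^ a ∧
      ∀ N' M' : Subgroup G, Chief N' M' → ⁅derivedSeries G (fb q a), M'⁆ ≤ N' := by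
  have hex : ∀ P : Subgroup G × Subgroup G, Chief P.1 P.2 → ∃ q a : ℕ, q.Prime ∧ 0 < a ∧
      P.1.relIndex P.2 = q ^ a ∧ ⁅derivedSeries G (fb q a), P.2⁆ ≤ P.1 := by
    intro P hP
    obtain ⟨-, q, a, h1, h2, h3, h4⟩ := chief_main hP
    exact ⟨q, a, h1, h2, h3, h4 (all_lin_per _).1⟩
  choose! q a h using hex
  obtain ⟨M0, hM0, -⟩ := exists_chief_above (G := G) (N := ⊥) (P := ⊤) inferInstance inferInstance
    bot_lt_top
  obtain ⟨P, hP, hmax⟩ := Set.exists_max_image {P : Subgroup G × Subgroup G | Chief P.1 P.2}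
    (fun P => fb (q P) (a P)) (Set.toFinite _) ⟨(⊥, M0), hM0⟩
  obtain ⟨h1, h2, h3, h4⟩ := h P hP
  refine ⟨P.1, P.2, q P, a P, hP, h1, h2, h3, ?_⟩
  intro N' M' hc
  refine le_trans (Subgroup.commutator_mono (derivedSeries_antitone G (hmax (N', M') hc)) le_rfl)
    (h (N', M') hc).2.2.2

open ArithmeticFunction in
lemma chain {G : Type*} [Group G] [Finite G] {N M : Subgroup G} (hc : Chief N M) {q a : ℕ}
    (hq : q.Prime) (ha : 0 < a) (hqa : N.relIndex M = q ^ a) (S : ℕ → Subgroup G)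
    (hn : ∀ j, (S j).Normal) (h0 : S 0 = ⊤) (m : ℕ) (hs : ∀ j < m, S (j + 1) < S j) :
    m + a ≤ cardFactors (Nat.card G) + 1 := by
  classical
  have hpos : ∀ T : Subgroup G, Nat.card T ≠ 0 := fun T => Nat.card_pos.ne'
  have hri : ∀ T U : Subgroup G, T.relIndex U ≠ 0 := fun T U => Subgroup.index_ne_zero_of_finite
  have hmono : ∀ x y : ℕ, y ≠ 0 → x ∣ y → cardFactors x ≤ cardFactors y := by
    rintro x _ hy ⟨z, rfl⟩
    rw [cardFactors_mul (left_ne_zero_of_mul hy) (right_ne_zero_of_mul hy)]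
    omega
  have hap : cardFactors (q ^ a) = a := cardFactors_apply_prime_pow hq
  have hnot : ∀ T : Subgroup G, T.Normal → ¬ M ⊓ T ≤ N → N.relIndex (M ⊓ T) = q ^ a := by
    intro T hT hnle
    have hMn := hc.nM
    have hNn := hc.nN
    have h1 := hc.min (N ⊔ (M ⊓ T)) inferInstance le_sup_left (sup_le hc.lt.le inf_le_left)
    have h2 : N ⊔ (M ⊓ T) = M := by
      refine h1.resolve_left fun h => hnle ?_
      rw [← h]; exact le_sup_right
    rw [← Subgroup.relIndex_sup_left, h2, hqa]
  have key : ∀ j ≤ m, j + cardFactors (Nat.card (S j)) + (if M ⊓ S j ≤ N then a - 1 else 0) ≤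
      cardFactors (Nat.card G) := by
    intro j
    induction j with
    | zero =>
      intro _
      rw [h0, inf_top_eq, if_neg (not_le_of_gt hc.lt), Subgroup.card_top]
      omega
    | succ j ih =>
      intro hj
      have ih := ih (by omega)
      have hlt := hs j (by omega)
      have hcard : Nat.card (S (j + 1)) * (S (j + 1)).relIndex (S j) = Nat.card (S j) := by
        have := Subgroup.relIndex_mul_relIndex ⊥ (S (j + 1)) (S j) bot_le hlt.le
        rwa [Subgroup.relIndex_bot_left, Subgroup.relIndex_bot_left] at this
      have hom : cardFactors (Nat.card (S j)) = cardFactors (Nat.card (S (j + 1))) +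
          cardFactors ((S (j + 1)).relIndex (S j)) := by
        rw [← hcard, cardFactors_mul (hpos _) (hri _ _)]
      have hk1 : 1 ≤ cardFactors ((S (j + 1)).relIndex (S j)) := by
        have hne : (S (j + 1)).relIndex (S j) ≠ 1 := by
          intro h
          exact absurd (Subgroup.relIndex_eq_one.1 h) (not_le_of_gt hlt)
        have := hmono _ _ (hri (S (j + 1)) (S j)) (Nat.minFac_dvd _)
        rwa [cardFactors_apply_prime (Nat.minFac_prime hne)] at this
      by_cases h1 : M ⊓ S j ≤ N
      · rw [if_pos h1] at ih
        split_ifs <;> omega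
      · rw [if_neg h1] at ih
        split_ifs with h2
        · have h3 := hnot _ (hn j) h1
          have h4 : N.relIndex (M ⊓ S j) ∣ (M ⊓ S (j + 1)).relIndex (M ⊓ S j) :=
            Subgroup.relIndex_dvd_of_le_left _ h2
          have h5 : (M ⊓ S (j + 1)).relIndex (M ⊓ S j) = (S (j + 1)).relIndex (M ⊓ S j) := by
            rw [← Subgroup.inf_relIndex_right (S (j + 1)), ← Subgroup.inf_relIndex_right (M ⊓ S (j + 1))]
            congr 1
            ext x
            simp only [Subgroup.mem_inf]
            tauto
          have h6 : (S (j + 1)).relIndex (M ⊓ S j) ∣ (S (j + 1)).relIndex (S j) := by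
            haveI := hn (j + 1)
            rw [← Subgroup.relIndex_sup_left]
            refine Dvd.intro _ (Subgroup.relIndex_mul_relIndex (S (j + 1)) (S (j + 1) ⊔ (M ⊓ S j)) (S j)
              le_sup_left (sup_le hlt.le inf_le_right))
          rw [h5, h3] at h4
          have h7 := hmono _ _ (hri (S (j + 1)) (S j)) (h4.trans h6)
          rw [hap] at h7
          omega
        · omega
  have hfin := key m le_rfl
  split_ifs at hfin with h1
  · omega
  · have h2 := hnot _ (hn m) h1
    have h3 : N.relIndex (M ⊓ S m) ∣ Nat.card (M ⊓ S m : Subgroup G) := Subgroup.relIndex_dvd_card _ _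
    have h4 : Nat.card (M ⊓ S m : Subgroup G) ∣ Nat.card (S m) :=
      Subgroup.card_dvd_of_le inf_le_right
    rw [h2] at h3
    have h5 := hmono _ _ (hpos (S m)) (h3.trans h4)
    rw [hap] at h5
    omega

end DL

set_option linter.style.haveILetI false

namespace DL
universe u
open ArithmeticFunction

lemma amgm (a y : ℕ) : a ^ 9 * y ^ 5 * 14 ^ 14 ≤ 9 ^ 9 * 5 ^ 5 * (a + y) ^ 14 := by
  have h := Real.geom_mean_le_arith_mean2_weighted (w₁ := 9 / 14) (w₂ := 5 / 14)
    (p₁ := (a : ℝ) / 9) (p₂ := (y : ℝ) / 5) (by norm_num) (by norm_num) (by positivity)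
    (by positivity) (by norm_num)
  have h2 := pow_le_pow_left₀ (by positivity) h 14
  rw [mul_pow, ← Real.rpow_natCast, ← Real.rpow_natCast, ← Real.rpow_mul (by positivity),
    ← Real.rpow_mul (by positivity)] at h2
  have e1 : (9 / 14 : ℝ) * ((14 : ℕ) : ℝ) = ((9 : ℕ) : ℝ) := by norm_num
  have e2 : (5 / 14 : ℝ) * ((14 : ℕ) : ℝ) = ((5 : ℕ) : ℝ) := by norm_num
  rw [e1, e2, Real.rpow_natCast, Real.rpow_natCast] at h2
  have e3 : (9 / 14 * ((a : ℝ) / 9) + 5 / 14 * ((y : ℝ) / 5)) = ((a : ℝ) + y) / 14 := by ring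
  rw [e3, div_pow, div_pow, div_pow, div_mul_div_comm, div_le_div_iff₀ (by positivity)
    (by positivity)] at h2
  have h3 : (a : ℝ) ^ 9 * y ^ 5 * 14 ^ 14 ≤ 9 ^ 9 * 5 ^ 5 * ((a : ℝ) + y) ^ 14 := by linarith
  exact_mod_cast h3

lemma fin_num {x n : ℕ} (h : 2 ^ (5 * (x + 3)) < 2 ^ 15 * n ^ 14) : 9 ^ x < n ^ 9 := by
  have h1 : 2 ^ (5 * x) < n ^ 14 := by
    rw [show 5 * (x + 3) = 15 + 5 * x by ring, pow_add] at h
    exact lt_of_mul_lt_mul_left h (by positivity)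
  refine lt_of_pow_lt_pow_left₀ 14 (by positivity) ?_
  calc (9 ^ x) ^ 14 = (9 ^ 14) ^ x := by rw [← pow_mul, ← pow_mul, mul_comm]
    _ ≤ (2 ^ 45) ^ x := Nat.pow_le_pow_left (by norm_num) x
    _ = (2 ^ (5 * x)) ^ 9 := by rw [← pow_mul, ← pow_mul]; congr 1; ring
    _ < (n ^ 14) ^ 9 := Nat.pow_lt_pow_left h1 (by norm_num)
    _ = _ := by rw [← pow_mul, ← pow_mul]

lemma case_small {x n a q : ℕ} (ha : 0 < a) (han : a ≤ n) (hd : x + 3 ≤ fb q a) :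
    9 ^ x < n ^ 9 := by
  have h := fb_pow q a ha
  have h5 : 2 ^ (5 * (x + 3)) ≤ a ^ 9 * 2 ^ 23 :=
    (Nat.pow_le_pow_right (by norm_num) (by omega)).trans h
  refine lt_of_lt_of_le ?_ (Nat.pow_le_pow_left han 9)
  by_cases h1 : a = 1
  · subst h1; have := fb_one q; omega
  by_cases h2 : a = 2
  · subst h2
    have := fb_two q
    calc 9 ^ x ≤ 9 ^ 1 := Nat.pow_le_pow_right (by norm_num) (by omega)
      _ < _ := by norm_num
  by_cases h3 : a = 3
  · subst h3
    have hx : x ≤ 4 := by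
      by_contra hx
      have : 2 ^ 40 ≤ 2 ^ (5 * (x + 3)) := Nat.pow_le_pow_right (by norm_num) (by omega)
      have := this.trans h5
      norm_num at this
    calc 9 ^ x ≤ 9 ^ 4 := Nat.pow_le_pow_right (by norm_num) hx
      _ < _ := by norm_num
  · apply fin_num
    have h4 : 4 ^ 5 ≤ a ^ 5 := Nat.pow_le_pow_left (by omega) 5
    have : 0 < a ^ 9 := by positivity
    calc _ ≤ a ^ 9 * 2 ^ 23 := h5
      _ < a ^ 9 * (2 ^ 15 * a ^ 5) := by
        refine Nat.mul_lt_mul_of_pos_left ?_ this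
        norm_num at h4 ⊢; omega
      _ = _ := by ring

lemma case_big {x n a q e : ℕ} (ha : 0 < a) (han : a + 2 ^ e ≤ n) (hd : x + 3 = fb q a + (e + 1)) :
    9 ^ x < n ^ 9 := by
  apply fin_num
  have h := fb_pow q a ha
  set y := 2 ^ e with hy
  have hy0 : 0 < y := by positivity
  have hA := amgm a y
  have e1 : 2 ^ (5 * (x + 3)) = 2 ^ (5 * fb q a) * (2 ^ 5 * y ^ 5) := by
    rw [hd, hy, ← pow_mul, ← pow_add, ← pow_add]; congr 1; ring
  rw [e1]
  have hpos : 0 < a ^ 9 * y ^ 5 := by positivity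
  have h1 : 2 ^ (5 * fb q a) * (2 ^ 5 * y ^ 5) ≤ 2 ^ 28 * (a ^ 9 * y ^ 5) := by
    calc _ ≤ a ^ 9 * 2 ^ 23 * (2 ^ 5 * y ^ 5) := Nat.mul_le_mul_right _ h
      _ = _ := by ring
  have hn : (a + y) ^ 14 ≤ n ^ 14 := Nat.pow_le_pow_left han 14
  have h2 : 2 ^ 13 * (a ^ 9 * y ^ 5) < n ^ 14 := by
    generalize a ^ 9 * y ^ 5 = A at *
    generalize (a + y) ^ 14 = B at *
    norm_num at hA ⊢
    omega
  calc _ ≤ _ := h1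
    _ = 2 ^ 15 * (2 ^ 13 * (a ^ 9 * y ^ 5)) := by ring
    _ < _ := Nat.mul_lt_mul_of_pos_left h2 (by norm_num)

lemma main_nat (G : Type u) [Group G] [Finite G] [Group.IsSolvable G] [Nontrivial G] (d : ℕ)
    (hd : ∀ k < d, derivedSeries G k ≠ ⊥) :
    0 < cardFactors (Nat.card G) ∧ ∀ x, d = x + 3 → 9 ^ x < cardFactors (Nat.card G) ^ 9 := by
  obtain ⟨N, M, q, a, hc, hq, ha, hqa, hall⟩ := exists_t0 G
  have han : a ≤ cardFactors (Nat.card G) := by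
    have := chain hc hq ha hqa (fun j => if j = 0 then ⊤ else ⊥)
      (by intro j; split_ifs <;> infer_instance) (by simp) 1
      (by intro j hj
          have : j = 0 := by omega
          subst this; simp [bot_lt_top])
    omega
  refine ⟨by omega, ?_⟩
  rintro x rfl
  by_cases hle : x + 3 ≤ fb q a
  · exact case_small ha han hle
  obtain ⟨e, he⟩ : ∃ e, x + 3 = fb q a + (e + 1) := ⟨x + 3 - fb q a - 1, by omega⟩
  haveI hLn := derivedSeries_normal G (fb q a)
  have hlt : ∀ j < 2 ^ e, lcs (derivedSeries G (fb q a)) (j + 1) <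
      lcs (derivedSeries G (fb q a)) j := by
    intro j hj
    refine lcs_lt _ hall ?_
    intro hb
    apply hd (fb q a + e) (by omega)
    rw [← le_bot_iff, ← hb]
    exact (derived_le_lcs _ _).trans (lcs_anti _ (by omega))
  by_cases ht : fb q a = 0
  · have := chain hc hq ha hqa (fun j => lcs (derivedSeries G (fb q a)) j)
      (fun j => lcs_normal _ j) (by simp [ht, lcs]) (2 ^ e) hlt
    have hle2 : 2 ^ e ≤ cardFactors (Nat.card G) := by omega
    have hex : e = x + 2 := by omega
    subst hex
    calc 9 ^ x ≤ (2 ^ 4) ^ x := Nat.pow_le_pow_left (by norm_num) x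
      _ = 2 ^ (4 * x) := by rw [← pow_mul]
      _ < 2 ^ ((x + 2) * 9) := Nat.pow_lt_pow_right (by norm_num) (by omega)
      _ = (2 ^ (x + 2)) ^ 9 := by rw [pow_mul]
      _ ≤ _ := Nat.pow_le_pow_left hle2 9
  · have := chain hc hq ha hqa
      (fun j => Nat.casesOn j ⊤ (fun i => lcs (derivedSeries G (fb q a)) i))
      (by rintro (_ | j)
          · exact (inferInstance : (⊤ : Subgroup G).Normal)
          · exact lcs_normal _ j) rfl (2 ^ e + 1)
      (by rintro (_ | j) hj
          · change derivedSeries G (fb q a) < ⊤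
            refine lt_of_le_of_lt (derivedSeries_antitone G (show 1 ≤ fb q a by omega)) ?_
            rw [derivedSeries_one]
            exact Group.IsSolvable.commutator_lt_top_of_nontrivial G
          · exact hlt j (by omega))
    exact case_big (q := q) (e := e) ha (by omega) he

end DL

/-- Every nontrivial finite solvable group `G` with derived length `d` satisfies
`9^((d−3)/9) < Ω(|G|)`. -/
theorem nine_rpow_lt_comp_length (G : Type*) [Group G] [Finite G] [Nontrivial G]
    (hG : IsSolvable G) (d : ℕ) (hd : DerivedLengthEq G d) :
    (9 : ℝ) ^ (((d : ℝ) - 3) / 9) < (Omega (Nat.card G) : ℝ) := by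
  haveI : Group.IsSolvable G := hG
  obtain ⟨hn, hx⟩ := DL.main_nat G d hd.2
  have hO : Omega (Nat.card G) = ArithmeticFunction.cardFactors (Nat.card G) :=
    (ArithmeticFunction.cardFactors_apply).symm
  rw [hO]
  generalize ArithmeticFunction.cardFactors (Nat.card G) = n at *
  by_cases h3 : d < 3
  · have h3' : (d : ℝ) < 3 := by exact_mod_cast h3
    calc (9 : ℝ) ^ (((d : ℝ) - 3) / 9) < 1 :=
          Real.rpow_lt_one_of_one_lt_of_neg (by norm_num) (by linarith)
      _ ≤ _ := by exact_mod_cast hn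
  · obtain ⟨x, rfl⟩ : ∃ x, d = x + 3 := ⟨d - 3, by omega⟩
    refine lt_of_pow_lt_pow_left₀ 9 (by positivity) ?_
    rw [← Real.rpow_natCast, ← Real.rpow_mul (by norm_num)]
    have e : (((x + 3 : ℕ) : ℝ) - 3) / 9 * ((9 : ℕ) : ℝ) = (x : ℝ) := by push_cast; ring
    rw [e, Real.rpow_natCast]
    exact_mod_cast hx x rfl
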